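/- arXiv:2009.02953 — 2 statements merged into one kernel-verified Lean document; each statement's English description precedes it below -/
import Mathlib

section
/- Let 𝒞 be a hereditary class of graphs and let 𝒞⃗ denote the class of all orientations of the graphs in 𝒞. Then the following are equivalent: (i) every connected acyclically oriented graph has a restricted dual for the class 𝒞⃗; (ii) the class 𝒞 has ω-bounded expansion. -/
open SimpleGraph

/-! ## Basic containment relations between graphs -/

/-- `H` is isomorphic to a (not necessarily induced) subgraph of `G`. -/
def IsSubgraphOf {V W : Type*} (H : SimpleGraph V) (G : SimpleGraph W) : Prop :=
  ∃ f : H →g G, Function.Injective f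

/-- `H` is isomorphic to an induced subgraph of `G`. -/
def IsInducedSubgraphOf {V W : Type*} (H : SimpleGraph V) (G : SimpleGraph W) : Prop :=
  Nonempty (H ↪g G)

/-- The clique number `ω(G)`: the largest `m` such that `K_m` is a subgraph of `G`. -/
noncomputable def omegaNum {V : Type*} (G : SimpleGraph V) : ℕ :=
  sSup {m | IsSubgraphOf (⊤ : SimpleGraph (Fin m)) G}

/-- The chromatic number `χ(G)` (as a natural number). -/
noncomputable def chi {V : Type*} (G : SimpleGraph V) : ℕ :=
  sInf {N | G.Colorable N}

/-! ## Tree-depth and the invariants `χ_p` -/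

/-- A forest order: a partial order in which the down-set of every element is a chain.
Such orders are exactly the ancestor orders of rooted forests. -/
def IsForestOrder {V : Type*} (r : V → V → Prop) : Prop :=
  (∀ v, r v v) ∧ (∀ u v, r u v → r v u → u = v) ∧
  (∀ u v w, r u v → r v w → r u w) ∧
  (∀ u v w, r u w → r v w → r u v ∨ r v u)

/-- `G` has tree-depth at most `h`: `G` is a subgraph of the closure of a rooted forest
of height at most `h` (height = maximum number of vertices on a root-to-leaf path). -/
def TreeDepthLE {V : Type*} (G : SimpleGraph V) (h : ℕ) : Prop :=
  ∃ r : V → V → Prop, IsForestOrder r ∧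
    (∀ u v, G.Adj u v → r u v ∨ r v u) ∧
    (∀ v, {u | r u v}.ncard ≤ h)

/-- The tree-depth `td(G)`. -/
noncomputable def treeDepth {V : Type*} (G : SimpleGraph V) : ℕ :=
  sInf {h | TreeDepthLE G h}

/-- `χ_p(G)`: the least number of colors of a vertex coloring such that every set `I` of at
most `p` colors induces a subgraph of tree-depth at most `|I|`. -/
noncomputable def chiP {V : Type*} (G : SimpleGraph V) (p : ℕ) : ℕ :=
  sInf {N | ∃ c : V → Fin N, ∀ I : Finset (Fin N), I.card ≤ p →
    TreeDepthLE (G.induce {v | c v ∈ I}) I.card}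

/-! ## Star colorings -/

/-- A star coloring: a proper coloring with no path on `4` vertices using only two colors. -/
def IsStarColoring {V α : Type*} (G : SimpleGraph V) (c : V → α) : Prop :=
  (∀ u v, G.Adj u v → c u ≠ c v) ∧
  ∀ x y z w : V, G.Adj x y → G.Adj y z → G.Adj z w →
    x ≠ z → y ≠ w → x ≠ w → ¬(c x = c z ∧ c y = c w)

/-- The star chromatic number `χ_s(G)`. -/
noncomputable def starChi {V : Type*} (G : SimpleGraph V) : ℕ :=
  sInf {N | ∃ c : V → Fin N, IsStarColoring G c}

/-! ## Subdivisions -/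

/-- The edges of a graph on `Fin n`, presented as increasingly ordered pairs. -/
def Edges {n : ℕ} (H : SimpleGraph (Fin n)) : Type :=
  {p : Fin n × Fin n // p.1 < p.2 ∧ H.Adj p.1 p.2}

/-- Base relation of the subdivision of `H`, where the edge `e` receives `t e` internal
vertices. -/
def subdivRel {n : ℕ} (H : SimpleGraph (Fin n)) (t : Edges H → ℕ) :
    (Fin n ⊕ Σ e : Edges H, Fin (t e)) → (Fin n ⊕ Σ e : Edges H, Fin (t e)) → Prop
  | Sum.inl u, Sum.inl v => ∃ h : u < v ∧ H.Adj u v, t ⟨(u, v), h⟩ = 0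
  | Sum.inl u, Sum.inr ⟨e, i⟩ =>
      (u = e.1.1 ∧ (i : ℕ) = 0) ∨ (u = e.1.2 ∧ (i : ℕ) + 1 = t e)
  | Sum.inr ⟨e, i⟩, Sum.inr ⟨e', j⟩ => e = e' ∧ (i : ℕ) + 1 = (j : ℕ)
  | _, _ => False

/-- The subdivision of `H` in which each edge `e` is replaced by a path with exactly `t e`
internal vertices. In particular `Subdiv H (fun _ => r)` is the `r`-subdivision `H^{(r)}`,
and the `(≤ r)`-subdivisions of `H` are the graphs `Subdiv H t` with `t e ≤ r` for all `e`. -/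
def Subdiv {n : ℕ} (H : SimpleGraph (Fin n)) (t : Edges H → ℕ) :
    SimpleGraph (Fin n ⊕ Σ e : Edges H, Fin (t e)) :=
  SimpleGraph.fromRel (subdivRel H t)

/-- `H ∈ TM_r(G)`: some `(≤ r)`-subdivision of `H` is a subgraph of `G`. -/
def MemTM {W : Type*} (r : ℕ) (G : SimpleGraph W) {n : ℕ} (H : SimpleGraph (Fin n)) : Prop :=
  ∃ t : Edges H → ℕ, (∀ e, t e ≤ r) ∧ IsSubgraphOf (Subdiv H t) G

/-- `H ∈ ITM_r^e(G)`: the exact `r`-subdivision of `H` is an induced subgraph of `G`. -/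
def MemITM {W : Type*} (r : ℕ) (G : SimpleGraph W) {n : ℕ} (H : SimpleGraph (Fin n)) : Prop :=
  IsInducedSubgraphOf (Subdiv H (fun _ => r)) G

/-- `ω(TM_r(G))`: the supremum of the clique numbers of the graphs in `TM_r(G)`. -/
noncomputable def omegaTM {W : Type*} (r : ℕ) (G : SimpleGraph W) : ℕ :=
  sSup {m | ∃ (k : ℕ) (H : SimpleGraph (Fin k)), MemTM r G H ∧ omegaNum H = m}

/-- The biclique number `bω(G)`: the largest `s` with `K_{s,s}` a subgraph of `G`. -/
noncomputable def bomega {V : Type*} (G : SimpleGraph V) : ℕ :=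
  sSup {s | IsSubgraphOf (completeBipartiteGraph (Fin s) (Fin s)) G}

/-- The average degree `d̄(G) = 2|E(G)|/|V(G)|`. -/
noncomputable def avgDeg {n : ℕ} (G : SimpleGraph (Fin n)) : ℝ :=
  2 * (G.edgeSet.ncard : ℝ) / n

/-! ## Classes of graphs -/

/-- A class of (finite, simple) graphs: for each `n`, a set of graphs on `Fin n`.
Classes are implicitly closed under isomorphism via the relations used below. -/
def GraphClass := ∀ n : ℕ, Set (SimpleGraph (Fin n))

/-- A hereditary class: closed under induced subgraphs (hence under isomorphism). -/
def Hereditary (C : GraphClass) : Prop :=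
  ∀ ⦃n m : ℕ⦄ (G : SimpleGraph (Fin n)) (H : SimpleGraph (Fin m)),
    G ∈ C n → IsInducedSubgraphOf H G → H ∈ C m

/-- A monotone class: closed under subgraphs (hence under isomorphism). -/
def MonotoneClass (C : GraphClass) : Prop :=
  ∀ ⦃n m : ℕ⦄ (G : SimpleGraph (Fin n)) (H : SimpleGraph (Fin m)),
    G ∈ C n → IsSubgraphOf H G → H ∈ C m

/-- `H ∈ TM_r(𝒞)`. -/
def MemTMClass (r : ℕ) (C : GraphClass) {m : ℕ} (H : SimpleGraph (Fin m)) : Prop :=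
  ∃ (n : ℕ) (G : SimpleGraph (Fin n)), G ∈ C n ∧ MemTM r G H

/-- `H ∈ ITM_r^e(𝒞)`. -/
def MemITMClass (r : ℕ) (C : GraphClass) {m : ℕ} (H : SimpleGraph (Fin m)) : Prop :=
  ∃ (n : ℕ) (G : SimpleGraph (Fin n)), G ∈ C n ∧ MemITM r G H

/-- `𝒞` is `χ`-bounded: `χ(H) ≤ f(ω(H))` for every induced subgraph `H` of a graph of `𝒞`. -/
def ChiBounded (C : GraphClass) : Prop :=
  ∃ f : ℕ → ℕ, ∀ ⦃n : ℕ⦄ (G : SimpleGraph (Fin n)), G ∈ C n →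
    ∀ ⦃m : ℕ⦄ (H : SimpleGraph (Fin m)), IsInducedSubgraphOf H G →
      chi H ≤ f (omegaNum H)

/-- `𝒞` has bounded expansion: for every `r`, `d̄(TM_r(𝒞)) < ∞`. -/
def BoundedExpansion (C : GraphClass) : Prop :=
  ∀ r : ℕ, ∃ d : ℝ, ∀ ⦃m : ℕ⦄ (H : SimpleGraph (Fin m)), MemTMClass r C H → avgDeg H ≤ d

/-- `𝒞` has `ω`-bounded expansion. -/
def OmegaBoundedExpansion (C : GraphClass) : Prop :=
  ∃ f : ℕ → ℕ → ℝ, ∀ ⦃n : ℕ⦄ (G : SimpleGraph (Fin n)), G ∈ C n →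
    ∀ (r : ℕ) ⦃m : ℕ⦄ (H : SimpleGraph (Fin m)), MemTM r G H →
      avgDeg H ≤ f (omegaNum G) r

/-- `𝒞` is nowhere dense: for every `r`, `ω(TM_r(𝒞)) < ∞`. -/
def NowhereDense (C : GraphClass) : Prop :=
  ∀ r : ℕ, ∃ c : ℕ, ∀ ⦃m : ℕ⦄ (H : SimpleGraph (Fin m)), MemTMClass r C H → omegaNum H ≤ c

/-- `𝒞` is strongly `χ_p`-bounded: `χ_p(G) ≤ f_p(ω(G))` on `𝒞`. -/
def StronglyChiPBounded (C : GraphClass) (p : ℕ) : Prop :=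
  ∃ f : ℕ → ℕ, ∀ ⦃n : ℕ⦄ (G : SimpleGraph (Fin n)), G ∈ C n → chiP G p ≤ f (omegaNum G)

/-- `𝒞` is weakly `χ_p`-bounded: `χ_p(G) ≤ g_p(ω(TM_{p-1}(G)))` on `𝒞`. -/
def WeaklyChiPBounded (C : GraphClass) (p : ℕ) : Prop :=
  ∃ g : ℕ → ℕ, ∀ ⦃n : ℕ⦄ (G : SimpleGraph (Fin n)), G ∈ C n → chiP G p ≤ g (omegaTM (p - 1) G)

/-! ## Directed graphs, orientations and restricted dualities -/

/-- Existence of a homomorphism between directed graphs presented as binary relations. -/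
def DigraphHomEx {n m : ℕ} (A : Fin n → Fin n → Prop) (B : Fin m → Fin m → Prop) : Prop :=
  ∃ f : Fin n → Fin m, ∀ u v, A u v → B (f u) (f v)

/-- `A` is an orientation of the graph `G`. -/
def IsOrientationOf {n : ℕ} (A : Fin n → Fin n → Prop) (G : SimpleGraph (Fin n)) : Prop :=
  (∀ u v, ¬(A u v ∧ A v u)) ∧ (∀ u v, G.Adj u v ↔ (A u v ∨ A v u))

/-- A directed graph is acyclic if it has no directed cycle. -/
def IsAcyclicDigraph {n : ℕ} (A : Fin n → Fin n → Prop) : Prop :=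
  ∀ v, ¬ Relation.TransGen A v v

/-- The directed graph `F` has a restricted dual for the class of all orientations of the
graphs of `𝒞`. -/
def HasRestrictedDualForOrientations (C : GraphClass) {nF : ℕ}
    (F : Fin nF → Fin nF → Prop) : Prop :=
  ∃ (m : ℕ) (D : Fin m → Fin m → Prop),
    ¬ DigraphHomEx F D ∧
    ∀ ⦃n : ℕ⦄ (A : Fin n → Fin n → Prop) (G : SimpleGraph (Fin n)),
      G ∈ C n → IsOrientationOf A G →
      (¬ DigraphHomEx F A ↔ DigraphHomEx A D)

/-! ## Holes -/

/-- The number `h_g(G)` of holes of length `g` in `G`, i.e. of vertex subsets inducing a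
cycle on `g` vertices. -/
noncomputable def holeCount {n : ℕ} (g : ℕ) (G : SimpleGraph (Fin n)) : ℕ :=
  {S : Set (Fin n) | Nonempty (G.induce S ≃g SimpleGraph.cycleGraph g)}.ncard

/-- `G` is even hole-free: it has no induced cycle of even length at least `4`. -/
def EvenHoleFree {n : ℕ} (G : SimpleGraph (Fin n)) : Prop :=
  ∀ g : ℕ, 4 ≤ g → Even g → holeCount g G = 0

namespace RestrictedDuals

open Classical

/-! ## Degeneracy -/

/-- `G` is `d`-degenerate: every nonempty set of vertices contains a vertex with at most `d`
neighbours in the set. -/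
def Degenerate {V : Type} [Fintype V] (G : SimpleGraph V) (d : ℕ) : Prop :=
  ∀ U : Finset V, U.Nonempty → ∃ v ∈ U, (U.filter (G.Adj v)).card ≤ d

theorem Degenerate.exists_out {V : Type} [Fintype V] {G : SimpleGraph V} {d : ℕ}
    (h : Degenerate G d) :
    ∃ out : V → Finset V, (∀ v, (out v).card ≤ d) ∧ (∀ v, ∀ u ∈ out v, G.Adj v u) ∧
      ∀ x y, G.Adj x y → y ∈ out x ∨ x ∈ out y := by
  suffices H : ∀ U : Finset V, ∃ out : V → Finset V, (∀ v, (out v).card ≤ d) ∧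
      (∀ v, ∀ u ∈ out v, G.Adj v u) ∧
      ∀ x ∈ U, ∀ y ∈ U, G.Adj x y → y ∈ out x ∨ x ∈ out y by
    obtain ⟨out, h1, h2, h3⟩ := H Finset.univ
    exact ⟨out, h1, h2, fun x y => h3 x (Finset.mem_univ _) y (Finset.mem_univ _)⟩
  intro U
  induction U using Finset.strongInduction with
  | H U ih =>
    rcases U.eq_empty_or_nonempty with rfl | hU
    · exact ⟨fun _ => ∅, by simp, by simp, by simp⟩
    obtain ⟨v, hv, hd⟩ := h U hU
    obtain ⟨out, h1, h2, h3⟩ := ih _ (Finset.erase_ssubset hv)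
    refine ⟨Function.update out v (U.filter (G.Adj v)), ?_, ?_, ?_⟩
    · intro w
      by_cases hw : w = v
      · subst hw; simpa using hd
      · simpa [Function.update_of_ne hw] using h1 w
    · intro w u
      by_cases hw : w = v
      · subst hw; simp
      · simpa [Function.update_of_ne hw] using h2 w u
    · intro x hx y hy hxy
      by_cases hxv : x = v
      · subst hxv; left; simp [hy, hxy]
      by_cases hyv : y = v
      · subst hyv; right; simp [hx, hxy.symm]
      rw [Function.update_of_ne hxv, Function.update_of_ne hyv]
      exact h3 x (Finset.mem_erase.2 ⟨hxv, hx⟩) y (Finset.mem_erase.2 ⟨hyv, hy⟩) hxy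

theorem Degenerate.exists_coloring {V : Type} [Fintype V] {G : SimpleGraph V} {d : ℕ}
    (h : Degenerate G d) : ∃ c : V → Fin (d + 1), ∀ x y, G.Adj x y → c x ≠ c y := by
  suffices H : ∀ U : Finset V, ∃ c : V → Fin (d + 1), ∀ x ∈ U, ∀ y ∈ U, G.Adj x y → c x ≠ c y by
    obtain ⟨c, hc⟩ := H Finset.univ
    exact ⟨c, fun x y => hc x (Finset.mem_univ _) y (Finset.mem_univ _)⟩
  intro U
  induction U using Finset.strongInduction with
  | H U ih =>
    rcases U.eq_empty_or_nonempty with rfl | hU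
    · exact ⟨fun _ => 0, by simp⟩
    obtain ⟨v, hv, hd⟩ := h U hU
    obtain ⟨c, hc⟩ := ih _ (Finset.erase_ssubset hv)
    have hlt : ((U.filter (G.Adj v)).image c).card < (Finset.univ : Finset (Fin (d + 1))).card := by
      rw [Finset.card_univ, Fintype.card_fin]
      exact Nat.lt_succ_of_le (Finset.card_image_le.trans hd)
    obtain ⟨a, -, ha⟩ := Finset.exists_mem_notMem_of_card_lt_card hlt
    have ha' : ∀ y ∈ U, G.Adj v y → c y ≠ a := fun y hy hvy hya =>
      ha (Finset.mem_image.2 ⟨y, Finset.mem_filter.2 ⟨hy, hvy⟩, hya⟩)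
    refine ⟨Function.update c v a, ?_⟩
    intro x hx y hy hxy
    by_cases hxv : x = v
    · subst hxv
      rw [Function.update_self, Function.update_of_ne hxy.ne']
      exact (ha' y hy hxy).symm
    by_cases hyv : y = v
    · subst hyv
      rw [Function.update_self, Function.update_of_ne hxy.ne]
      exact ha' x hx hxy.symm
    rw [Function.update_of_ne hxv, Function.update_of_ne hyv]
    exact hc x (Finset.mem_erase.2 ⟨hxv, hx⟩) y (Finset.mem_erase.2 ⟨hyv, hy⟩) hxy

theorem degenerate_of_out {V : Type} [Fintype V] {G : SimpleGraph V} {M : ℕ}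
    (out : V → Finset V) (hout : ∀ v, (out v).card ≤ M)
    (hG : ∀ x y, G.Adj x y → y ∈ out x ∨ x ∈ out y) : Degenerate G (2 * M) := by
  intro U hU
  have hsum : ∑ v ∈ U, (U.filter (G.Adj v)).card ≤ ∑ _v ∈ U, 2 * M := by
    calc ∑ v ∈ U, (U.filter (G.Adj v)).card
        ≤ ∑ v ∈ U, ((U.filter (fun u => u ∈ out v)).card +
            (U.filter (fun u => v ∈ out u)).card) := by
          refine Finset.sum_le_sum fun v _ => ?_
          refine le_trans (Finset.card_le_card ?_) (Finset.card_union_le _ _)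
          intro u hu
          rw [Finset.mem_filter] at hu
          rcases hG v u hu.2 with h | h
          · exact Finset.mem_union_left _ (Finset.mem_filter.2 ⟨hu.1, h⟩)
          · exact Finset.mem_union_right _ (Finset.mem_filter.2 ⟨hu.1, h⟩)
      _ = ∑ v ∈ U, (U.filter (fun u => u ∈ out v)).card +
            ∑ v ∈ U, (U.filter (fun u => u ∈ out v)).card := by
          rw [Finset.sum_add_distrib]
          congr 1
          simp only [Finset.card_filter]
          exact Finset.sum_comm
      _ ≤ ∑ _v ∈ U, M + ∑ _v ∈ U, M := by
          have : ∀ v ∈ U, (U.filter (fun u => u ∈ out v)).card ≤ M := fun v _ =>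
            (Finset.card_le_card fun u hu => (Finset.mem_filter.1 hu).2).trans (hout v)
          exact add_le_add (Finset.sum_le_sum this) (Finset.sum_le_sum this)
      _ = ∑ _v ∈ U, 2 * M := by rw [← Finset.sum_add_distrib]; simp [two_mul]
  exact Finset.exists_le_of_sum_le hU hsum

/-- A relation with bounded out-degree admits a proper coloring with boundedly many colors. -/
theorem exists_coloring_of_out {α : Type} [Fintype α] {M : ℕ} (out : α → Finset α)
    (hout : ∀ v, (out v).card ≤ M) :
    ∃ c : α → Fin (2 * M + 1), ∀ x y, x ≠ y → y ∈ out x → c x ≠ c y := by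
  have h := degenerate_of_out (G := SimpleGraph.fromRel fun x y => y ∈ out x) out hout
    (fun x y hxy => by simpa using ((SimpleGraph.fromRel_adj _ _ _).1 hxy).2)
  obtain ⟨c, hc⟩ := h.exists_coloring
  exact ⟨c, fun x y hxy hy => hc x y ((SimpleGraph.fromRel_adj _ _ _).2 ⟨hxy, Or.inl hy⟩)⟩

/-! ## Selecting many non-conflicting edges -/

theorem exists_finset_separating {V E : Type} [Fintype V] (S : Finset E) (a b : E → V)
    (Z : E → Finset V) (m : ℕ) (hZ : ∀ e, (Z e).card ≤ m) (ha : ∀ e, a e ∉ Z e)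
    (hb : ∀ e, b e ∉ Z e) :
    ∃ W : Finset V, S.card ≤
      2 ^ (m + 2) * (S.filter fun e => a e ∈ W ∧ b e ∈ W ∧ Disjoint (Z e) W).card := by
  by_contra! hcon
  have hcount : ∀ e, 2 ^ Fintype.card V ≤ 2 ^ (m + 2) *
      ((Finset.univ : Finset (Finset V)).filter
        fun W => a e ∈ W ∧ b e ∈ W ∧ Disjoint (Z e) W).card := by
    intro e
    set Y : Finset V := insert (a e) (insert (b e) (Z e)) with hY
    have hYc : Y.card ≤ m + 2 :=
      (Finset.card_insert_le _ _).trans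
        (Nat.succ_le_succ ((Finset.card_insert_le _ _).trans (Nat.succ_le_succ (hZ e))))
    have h1 : (Finset.powerset Yᶜ).card ≤ ((Finset.univ : Finset (Finset V)).filter
        fun W => a e ∈ W ∧ b e ∈ W ∧ Disjoint (Z e) W).card := by
      refine Finset.card_le_card_of_injOn (fun X => X ∪ {a e, b e}) ?_ ?_
      · intro X hX
        have hX' : X ⊆ Yᶜ := Finset.mem_powerset.1 hX
        simp only [Finset.coe_filter, Finset.mem_univ, true_and, Set.mem_ofPred_eq]
        refine ⟨by simp, by simp, ?_⟩
        rw [Finset.disjoint_left]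
        intro z hz hz'
        rcases Finset.mem_union.1 hz' with h | h
        · have := Finset.mem_compl.1 (hX' h)
          exact this (by simp [hY, hz])
        · rcases Finset.mem_insert.1 h with h | h
          · exact ha e (h ▸ hz)
          · exact hb e ((Finset.mem_singleton.1 h) ▸ hz)
      · intro X hX X' hX' hXX
        have h1 : ∀ X : Finset V, X ∈ Finset.powerset Yᶜ → X = (X ∪ {a e, b e}) \ {a e, b e} := by
          intro X hX
          have hX' : X ⊆ Yᶜ := Finset.mem_powerset.1 hX
          rw [Finset.union_sdiff_right, Finset.sdiff_eq_self_of_disjoint]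
          rw [Finset.disjoint_left]
          intro z hz hz'
          have := Finset.mem_compl.1 (hX' hz)
          apply this
          rcases Finset.mem_insert.1 hz' with h | h
          · simp [hY, h]
          · simp [hY, Finset.mem_singleton.1 h]
        rw [h1 X hX, h1 X' hX']
        exact congrArg (· \ {a e, b e}) hXX
    rw [Finset.card_powerset, Finset.card_compl] at h1
    calc 2 ^ Fintype.card V ≤ 2 ^ (m + 2 + (Fintype.card V - Y.card)) :=
          Nat.pow_le_pow_right (by norm_num) (by omega)
      _ = 2 ^ (m + 2) * 2 ^ (Fintype.card V - Y.card) := pow_add _ _ _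
      _ ≤ _ := Nat.mul_le_mul_left _ h1
  have hsw : ∑ W : Finset V, (S.filter fun e => a e ∈ W ∧ b e ∈ W ∧ Disjoint (Z e) W).card =
      ∑ e ∈ S, ((Finset.univ : Finset (Finset V)).filter
        fun W => a e ∈ W ∧ b e ∈ W ∧ Disjoint (Z e) W).card := by
    simp only [Finset.card_filter]
    exact Finset.sum_comm
  have h1 : ∑ W : Finset V, 2 ^ (m + 2) *
      (S.filter fun e => a e ∈ W ∧ b e ∈ W ∧ Disjoint (Z e) W).card < ∑ _W : Finset V, S.card :=
    Finset.sum_lt_sum_of_nonempty ⟨∅, Finset.mem_univ _⟩ fun W _ => hcon W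
  have h2 : ∑ e ∈ S, 2 ^ Fintype.card V ≤ ∑ W : Finset V, 2 ^ (m + 2) *
      (S.filter fun e => a e ∈ W ∧ b e ∈ W ∧ Disjoint (Z e) W).card := by
    rw [← Finset.mul_sum, hsw, Finset.mul_sum]
    exact Finset.sum_le_sum fun e _ => hcount e
  have := lt_of_le_of_lt h2 h1
  simp [Finset.card_univ, Fintype.card_finset, mul_comm] at this

theorem exists_selection {V E : Type} [Fintype V] [Fintype E] (S : Finset E) (a b : E → V)
    (Z : E → Finset V) (conf : E → Finset E) (m M : ℕ) (hZ : ∀ e, (Z e).card ≤ m)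
    (ha : ∀ e, a e ∉ Z e) (hb : ∀ e, b e ∉ Z e) (hconf : ∀ e, (conf e).card ≤ M) :
    ∃ (W : Finset V) (T : Finset E), T ⊆ S ∧ S.card ≤ (2 * M + 1) * 2 ^ (m + 2) * T.card ∧
      (∀ e ∈ T, a e ∈ W ∧ b e ∈ W ∧ Disjoint (Z e) W) ∧
      ∀ e ∈ T, ∀ e' ∈ T, e ≠ e' → e' ∉ conf e := by
  obtain ⟨c, hc⟩ := exists_coloring_of_out conf hconf
  obtain ⟨i, hi⟩ : ∃ i, S.card ≤ (2 * M + 1) * (S.filter fun e => c e = i).card := by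
    by_contra! hcon
    have h1 := Finset.card_eq_sum_card_fiberwise (s := S) (t := Finset.univ) (f := c) (by simp)
    have h2 : ∑ i : Fin (2 * M + 1), (2 * M + 1) * (S.filter fun e => c e = i).card <
        ∑ _i : Fin (2 * M + 1), S.card :=
      Finset.sum_lt_sum_of_nonempty ⟨0, Finset.mem_univ _⟩ fun i _ => hcon i
    rw [← Finset.mul_sum, ← h1] at h2
    simp at h2
  obtain ⟨W, hW⟩ := exists_finset_separating (S.filter fun e => c e = i) a b Z m hZ ha hb
  refine ⟨W, (S.filter fun e => c e = i).filter fun e => a e ∈ W ∧ b e ∈ W ∧ Disjoint (Z e) W,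
    (Finset.filter_subset _ _).trans (Finset.filter_subset _ _), ?_, ?_, ?_⟩
  · calc S.card ≤ _ := hi
      _ ≤ _ := Nat.mul_le_mul_left _ hW
      _ = _ := by rw [mul_assoc]
  · intro e he
    exact (Finset.mem_filter.1 he).2
  · intro e he e' he' hne hmem
    have h1 := (Finset.mem_filter.1 (Finset.mem_filter.1 he).1).2
    have h2 := (Finset.mem_filter.1 (Finset.mem_filter.1 he').1).2
    exact hc e e' hne hmem (h1.trans h2.symm)

/-! ## Walks inside a region -/

/-- `x` and `y` are joined by a walk of `G` inside `S`. -/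
def Joined {V : Type} (G : SimpleGraph V) (S : Set V) (x y : V) : Prop :=
  ∃ p : G.Walk x y, ∀ v ∈ p.support, v ∈ S

theorem Joined.symm {V : Type} {G : SimpleGraph V} {S : Set V} {x y : V} (h : Joined G S x y) :
    Joined G S y x := by
  obtain ⟨p, hp⟩ := h
  exact ⟨p.reverse, by simpa using hp⟩

theorem Joined.trans {V : Type} {G : SimpleGraph V} {S : Set V} {x y z : V}
    (h : Joined G S x y) (h' : Joined G S y z) : Joined G S x z := by
  obtain ⟨p, hp⟩ := h
  obtain ⟨q, hq⟩ := h'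
  refine ⟨p.append q, fun v hv => ?_⟩
  rcases (SimpleGraph.Walk.mem_support_append_iff _ _).1 hv with h | h
  · exact hp v h
  · exact hq v h

theorem Joined.mono {V : Type} {G : SimpleGraph V} {S S' : Set V} {x y : V}
    (h : Joined G S x y) (hS : S ⊆ S') : Joined G S' x y := by
  obtain ⟨p, hp⟩ := h
  exact ⟨p, fun v hv => hS (hp v hv)⟩

theorem Joined.of_adj {V : Type} {G : SimpleGraph V} {S : Set V} {x y : V}
    (h : G.Adj x y) (hx : x ∈ S) (hy : y ∈ S) : Joined G S x y :=
  ⟨h.toWalk, by simp [hx, hy]⟩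

theorem Joined.refl {V : Type} {G : SimpleGraph V} {S : Set V} {x : V}
    (hx : x ∈ S) : Joined G S x x :=
  ⟨SimpleGraph.Walk.nil, by simp [hx]⟩

/-- A shortest path inside a region is induced. -/
theorem exists_induced_path {V : Type} {G : SimpleGraph V} {R : Finset V} {a b : V} (hab : a ≠ b)
    (h : Joined G {v | v = a ∨ v = b ∨ v ∈ R} a b) :
    ∃ (t : ℕ) (g : ℕ → V), t ≤ R.card ∧ g 0 = a ∧ g (t + 1) = b ∧
      (∀ i ≤ t, G.Adj (g i) (g (i + 1))) ∧
      (∀ i j, i ≤ t + 1 → j ≤ t + 1 → g i = g j → i = j) ∧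
      (∀ i, 1 ≤ i → i ≤ t → g i ∈ R) ∧
      (∀ i j, i ≤ t + 1 → j ≤ t + 1 → G.Adj (g i) (g j) → i + 1 = j ∨ j + 1 = i) := by
  have hex : ∃ n, ∃ p : G.Walk a b, (∀ v ∈ p.support, v ∈ {v | v = a ∨ v = b ∨ v ∈ R}) ∧
      p.length = n := by
    obtain ⟨p, hp⟩ := h
    exact ⟨_, p, hp, rfl⟩
  obtain ⟨p, hp, hlen⟩ := Nat.find_spec hex
  have hmin : ∀ q : G.Walk a b, (∀ v ∈ q.support, v ∈ {v | v = a ∨ v = b ∨ v ∈ R}) →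
      p.length ≤ q.length := by
    intro q hq
    rw [hlen]
    exact Nat.find_min' hex ⟨q, hq, rfl⟩
  have htake : ∀ i, ∀ v ∈ (p.take i).support, v ∈ p.support := by
    intro i v hv
    rw [SimpleGraph.Walk.support_take] at hv
    exact List.mem_of_mem_take hv
  have hdrop : ∀ i, ∀ v ∈ (p.drop i).support, v ∈ p.support := by
    intro i v hv
    obtain ⟨n, rfl, -⟩ := SimpleGraph.Walk.mem_support_iff_exists_getVert.1 hv
    rw [SimpleGraph.Walk.drop_getVert]
    exact SimpleGraph.Walk.getVert_mem_support _ _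
  have hinj : ∀ i j, i < j → j ≤ p.length → p.getVert i ≠ p.getVert j := by
    intro i j hij hj heq
    have := hmin ((p.take i).append ((p.drop j).copy heq.symm rfl)) (by
      intro v hv
      rcases (SimpleGraph.Walk.mem_support_append_iff _ _).1 hv with h | h
      · exact hp v (htake i v h)
      · rw [SimpleGraph.Walk.support_copy] at h
        exact hp v (hdrop j v h))
    simp only [SimpleGraph.Walk.length_append, SimpleGraph.Walk.length_copy,
      SimpleGraph.Walk.take_length, SimpleGraph.Walk.drop_length] at this
    omega
  have hind : ∀ i j, i < j → j ≤ p.length → G.Adj (p.getVert i) (p.getVert j) → i + 1 = j := by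
    intro i j hij hj hadj
    have := hmin ((p.take i).append (SimpleGraph.Walk.cons hadj (p.drop j))) (by
      intro v hv
      rcases (SimpleGraph.Walk.mem_support_append_iff _ _).1 hv with h | h
      · exact hp v (htake i v h)
      · rw [SimpleGraph.Walk.support_cons, List.mem_cons] at h
        rcases h with rfl | h
        · exact hp _ (SimpleGraph.Walk.getVert_mem_support _ _)
        · exact hp v (hdrop j v h))
    simp only [SimpleGraph.Walk.length_append, SimpleGraph.Walk.length_cons,
      SimpleGraph.Walk.take_length, SimpleGraph.Walk.drop_length] at this
    omega
  have hpos : 1 ≤ p.length := by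
    rcases Nat.eq_zero_or_pos p.length with h0 | h0
    · exact absurd (SimpleGraph.Walk.eq_of_length_eq_zero h0) hab
    · exact h0
  have hinj' : ∀ i j, i ≤ p.length → j ≤ p.length → p.getVert i = p.getVert j → i = j := by
    intro i j hi hj heq
    rcases lt_trichotomy i j with h | h | h
    · exact absurd heq (hinj i j h hj)
    · exact h
    · exact absurd heq.symm (hinj j i h hi)
  have hR : ∀ i, 1 ≤ i → i ≤ p.length - 1 → p.getVert i ∈ R := by
    intro i h1 h2
    rcases hp _ (SimpleGraph.Walk.getVert_mem_support p i) with h | h | h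
    · have := hinj' i 0 (by omega) (by omega) (by simpa using h)
      omega
    · have := hinj' i p.length (by omega) le_rfl (by simpa using h)
      omega
    · exact h
  refine ⟨p.length - 1, p.getVert, ?_, by simp, ?_, ?_, ?_, hR, ?_⟩
  · have := Finset.card_le_card_of_injOn (s := Finset.Icc 1 (p.length - 1)) (t := R) p.getVert
      (fun i hi => hR i (Finset.mem_Icc.1 hi).1 (Finset.mem_Icc.1 hi).2)
      (fun i hi j hj heq => hinj' i j (by have := Finset.mem_Icc.1 hi; omega)
        (by have := Finset.mem_Icc.1 hj; omega) heq)
    simpa using this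
  · rw [Nat.sub_add_cancel hpos]; simp
  · intro i hi
    exact p.adj_getVert_succ (by omega)
  · intro i j hi hj
    exact hinj' i j (by omega) (by omega)
  · intro i j hi hj hadj
    rcases lt_trichotomy i j with h | h | h
    · exact Or.inl (hind i j h (by omega) hadj)
    · subst h; exact absurd hadj (G.loopless.irrefl _)
    · exact Or.inr (hind j i h (by omega) hadj.symm)

/-! ## Edges and subdivisions -/

noncomputable instance {n : ℕ} (H : SimpleGraph (Fin n)) : Fintype (Edges H) :=
  inferInstanceAs (Fintype {p : Fin n × Fin n // p.1 < p.2 ∧ H.Adj p.1 p.2})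

theorem ncard_edgeSet {n : ℕ} (H : SimpleGraph (Fin n)) :
    H.edgeSet.ncard = Fintype.card (Edges H) := by
  rw [← Nat.card_eq_fintype_card, ← Nat.card_coe_set_eq]
  refine (Nat.card_congr (Equiv.ofBijective
    (fun e : Edges H => (⟨s(e.1.1, e.1.2), e.2.2⟩ : H.edgeSet)) ⟨?_, ?_⟩)).symm
  · rintro ⟨⟨a, b⟩, h1, h2⟩ ⟨⟨a', b'⟩, h1', h2'⟩ h
    have h2 : s(a, b) = s(a', b') := congrArg Subtype.val h
    apply Subtype.ext
    simp only at h1 h1'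
    rcases Sym2.eq_iff.1 h2 with ⟨rfl, rfl⟩ | ⟨rfl, rfl⟩
    · rfl
    · exact absurd h1 (lt_asymm h1')
  · rintro ⟨e, he⟩
    induction e using Sym2.ind with
    | _ x y =>
      rw [SimpleGraph.mem_edgeSet] at he
      rcases lt_or_gt_of_ne he.ne with h | h
      · exact ⟨⟨(x, y), h, he⟩, rfl⟩
      · exact ⟨⟨(y, x), h, he.symm⟩, Subtype.ext Sym2.eq_swap⟩

theorem card_edges_le_of_avgDeg_le {n : ℕ} {H : SimpleGraph (Fin n)} {d : ℝ} (h : avgDeg H ≤ d) :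
    Fintype.card (Edges H) ≤ ⌈d⌉₊ * n := by
  rcases Nat.eq_zero_or_pos n with rfl | hn
  · have : IsEmpty (Edges H) := ⟨fun e => e.1.1.elim0⟩
    simp
  · have hn' : (0 : ℝ) < n := by exact_mod_cast hn
    rw [avgDeg, ncard_edgeSet, div_le_iff₀ hn'] at h
    have h1 : (Fintype.card (Edges H) : ℝ) ≤ ⌈d⌉₊ * n := by
      have : d * n ≤ ⌈d⌉₊ * n := mul_le_mul_of_nonneg_right (Nat.le_ceil d) hn'.le
      have h0 : (0 : ℝ) ≤ Fintype.card (Edges H) := Nat.cast_nonneg _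
      linarith
    exact_mod_cast h1

theorem avgDeg_le_of_card_edges_le {n K : ℕ} {H : SimpleGraph (Fin n)}
    (h : Fintype.card (Edges H) ≤ K * n) : avgDeg H ≤ 2 * K := by
  rcases Nat.eq_zero_or_pos n with rfl | hn
  · simp [avgDeg]
  · have hn' : (0 : ℝ) < n := by exact_mod_cast hn
    rw [avgDeg, ncard_edgeSet, div_le_iff₀ hn']
    have h1 : (Fintype.card (Edges H) : ℝ) ≤ K * n := by exact_mod_cast h
    linarith

/-- The graph formed by a set `T` of edges of `H` and their ends. -/
theorem exists_graph_of_edges {n : ℕ} (H : SimpleGraph (Fin n)) (T : Finset (Edges H)) :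
    ∃ n' ≤ n, ∃ (H' : SimpleGraph (Fin n')) (ι : Fin n' ↪o Fin n) (τ : Edges H' → Edges H),
      Function.Injective τ ∧ (∀ e, (τ e).1.1 = ι e.1.1 ∧ (τ e).1.2 = ι e.1.2 ∧ τ e ∈ T) ∧
      Fintype.card (Edges H') = T.card ∧
      ∀ i, ∃ e ∈ T, ι i = e.1.1 ∨ ι i = e.1.2 := by
  set W : Finset (Fin n) := Finset.univ.filter fun i => ∃ e ∈ T, i = e.1.1 ∨ i = e.1.2 with hW
  set ι : Fin W.card ↪o Fin n := W.orderEmbOfFin rfl with hι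
  have hιW : ∀ i, ι i ∈ W := fun i => Finset.orderEmbOfFin_mem W rfl i
  have hsurj : ∀ x ∈ W, ∃ i, ι i = x := by
    intro x hx
    have : x ∈ Set.range ι := by rw [hι, Finset.range_orderEmbOfFin]; exact hx
    exact this
  let H' : SimpleGraph (Fin W.card) :=
    { Adj := fun i j => ∃ e ∈ T, (ι i = e.1.1 ∧ ι j = e.1.2) ∨ (ι j = e.1.1 ∧ ι i = e.1.2)
      symm := ⟨by
        rintro i j ⟨e, he, h⟩
        exact ⟨e, he, h.symm⟩⟩
      loopless := ⟨by
        rintro i ⟨e, he, ⟨h1, h2⟩ | ⟨h1, h2⟩⟩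
        · exact absurd e.2.1 (by rw [← h1, ← h2]; exact lt_irrefl _)
        · exact absurd e.2.1 (by rw [← h1, ← h2]; exact lt_irrefl _)⟩ }
  have key : ∀ e : Edges H', ∃ f ∈ T, ι e.1.1 = f.1.1 ∧ ι e.1.2 = f.1.2 := by
    rintro ⟨⟨i, j⟩, hij, f, hf, h | h⟩
    · exact ⟨f, hf, h⟩
    · exfalso
      have h1 : ι i < ι j := ι.lt_iff_lt.2 hij
      rw [h.1, h.2] at h1
      exact lt_asymm h1 f.2.1
  choose τ hτ1 hτ2 using key
  have hinj : Function.Injective τ := by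
    intro e e' h
    have h1 := hτ2 e
    have h2 := hτ2 e'
    rw [h] at h1
    apply Subtype.ext
    exact Prod.ext (ι.injective (h1.1.trans h2.1.symm)) (ι.injective (h1.2.trans h2.2.symm))
  have himg : Finset.univ.image τ = T := by
    ext f
    constructor
    · intro hf
      obtain ⟨e, -, rfl⟩ := Finset.mem_image.1 hf
      exact hτ1 e
    · intro hf
      obtain ⟨i, hi⟩ := hsurj f.1.1 (Finset.mem_filter.2 ⟨Finset.mem_univ _, f, hf, Or.inl rfl⟩)
      obtain ⟨j, hj⟩ := hsurj f.1.2 (Finset.mem_filter.2 ⟨Finset.mem_univ _, f, hf, Or.inr rfl⟩)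
      have hij : i < j := ι.lt_iff_lt.1 (by rw [hi, hj]; exact f.2.1)
      refine Finset.mem_image.2 ⟨⟨(i, j), hij, f, hf, Or.inl ⟨hi, hj⟩⟩, Finset.mem_univ _, ?_⟩
      have h1 := hτ2 ⟨(i, j), hij, f, hf, Or.inl ⟨hi, hj⟩⟩
      apply Subtype.ext
      exact Prod.ext (h1.1.symm.trans hi) (h1.2.symm.trans hj)
  refine ⟨W.card, by simpa using Finset.card_le_univ W, H', ι, τ, hinj,
    fun e => ⟨(hτ2 e).1.symm, (hτ2 e).2.symm, hτ1 e⟩, ?_, ?_⟩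
  · rw [← himg, Finset.card_image_of_injective _ hinj, Finset.card_univ]
  · intro i
    have := hιW i
    simpa only [hW, Finset.mem_filter, Finset.mem_univ, true_and] using this

/-- The map from a subdivision of `H` given by the branch vertices `σ` and the paths `g`. -/
def subdivMap {V : Type} {n : ℕ} {H : SimpleGraph (Fin n)} (t : Edges H → ℕ) (σ : Fin n → V)
    (g : Edges H → ℕ → V) : (Fin n ⊕ Σ e : Edges H, Fin (t e)) → V
  | Sum.inl i => σ i
  | Sum.inr ⟨e, k⟩ => g e (k + 1)

section subdivMap

variable {V : Type} {G : SimpleGraph V} {n : ℕ} {H : SimpleGraph (Fin n)} {t : Edges H → ℕ}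
  {σ : Fin n → V} {g : Edges H → ℕ → V} {R : Edges H → Finset V}

theorem subdivMap_injective (hσ : Function.Injective σ)
    (hinj : ∀ e i j, i ≤ t e + 1 → j ≤ t e + 1 → g e i = g e j → i = j)
    (hR : ∀ e i, 1 ≤ i → i ≤ t e → g e i ∈ R e)
    (hdisj : ∀ e e', e ≠ e' → Disjoint (R e) (R e')) (hRσ : ∀ e i, σ i ∉ R e) :
    Function.Injective (subdivMap t σ g) := by
  rintro (i | ⟨e, k⟩) (j | ⟨e', k'⟩) h
  · exact congrArg Sum.inl (hσ h)
  · exact absurd (show σ i ∈ R e' from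
      (show σ i = g e' (k' + 1) from h) ▸ hR e' (k' + 1) (by omega) k'.2) (hRσ _ _)
  · exact absurd (show σ j ∈ R e from
      (show σ j = g e (k + 1) from h.symm) ▸ hR e (k + 1) (by omega) k.2) (hRσ _ _)
  · have h' : g e (k + 1) = g e' (k' + 1) := h
    by_cases hee : e = e'
    · subst hee
      have := hinj e (k + 1) (k' + 1) (by omega) (by omega) h'
      have : k = k' := Fin.ext (by omega)
      rw [this]
    · exact absurd (h' ▸ hR e (k + 1) (by omega) k.2)
        (Finset.disjoint_right.1 (hdisj e e' hee) (hR e' (k' + 1) (by omega) k'.2))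

theorem subdivMap_adj (h0 : ∀ e, g e 0 = σ e.1.1) (h1 : ∀ e, g e (t e + 1) = σ e.1.2)
    (hadj : ∀ e, ∀ i ≤ t e, G.Adj (g e i) (g e (i + 1))) {x y}
    (h : (Subdiv H t).Adj x y) : G.Adj (subdivMap t σ g x) (subdivMap t σ g y) := by
  have key : ∀ x y, subdivRel H t x y → G.Adj (subdivMap t σ g x) (subdivMap t σ g y) := by
    rintro (i | ⟨e, k⟩) (j | ⟨e', k'⟩) h
    · obtain ⟨hij, ht⟩ := h
      have := hadj ⟨(i, j), hij⟩ 0 (Nat.zero_le _)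
      have h1' := h1 ⟨(i, j), hij⟩
      rw [ht] at h1'
      have h0' := h0 ⟨(i, j), hij⟩
      rw [h0', h1'] at this
      exact this
    · rcases h with ⟨rfl, hk⟩ | ⟨rfl, hk⟩
      · have := hadj e' 0 (Nat.zero_le _)
        rw [h0] at this
        simpa [subdivMap, hk] using this
      · have := hadj e' (t e') le_rfl
        rw [h1, ← hk] at this
        exact this.symm
    · exact absurd h (by simp [subdivRel])
    · obtain ⟨rfl, hk⟩ := h
      have := hadj e (k + 1) k.2
      simpa [subdivMap, hk] using this
  rcases ((SimpleGraph.fromRel_adj _ _ _).1 h).2 with h | h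
  · exact key _ _ h
  · exact (key _ _ h).symm

theorem subdivMap_adj_iff
    (hR : ∀ e i, 1 ≤ i → i ≤ t e → g e i ∈ R e)
    (h0 : ∀ e, g e 0 = σ e.1.1) (h1 : ∀ e, g e (t e + 1) = σ e.1.2)
    (hadj : ∀ e, ∀ i ≤ t e, G.Adj (g e i) (g e (i + 1)))
    (hσσ : ∀ i j, ¬ G.Adj (σ i) (σ j))
    (hσR : ∀ i e, ∀ x ∈ R e, G.Adj (σ i) x → i = e.1.1 ∨ i = e.1.2)
    (hRR : ∀ e e', e ≠ e' → ∀ x ∈ R e, ∀ y ∈ R e', ¬ G.Adj x y)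
    (hind : ∀ e i j, i ≤ t e + 1 → j ≤ t e + 1 → G.Adj (g e i) (g e j) → i + 1 = j ∨ j + 1 = i)
    (x y) : G.Adj (subdivMap t σ g x) (subdivMap t σ g y) ↔ (Subdiv H t).Adj x y := by
  refine ⟨fun h => ?_, subdivMap_adj h0 h1 hadj⟩
  have hmixed : ∀ i e (k : Fin (t e)), G.Adj (σ i) (g e (k + 1)) →
      subdivRel H t (Sum.inl i) (Sum.inr ⟨e, k⟩) := by
    intro i e k h
    rcases hσR i e _ (hR e (k + 1) (by omega) k.2) h with rfl | rfl
    · rw [← h0] at h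
      have := hind e 0 (k + 1) (by omega) (by omega) h
      exact Or.inl ⟨rfl, by omega⟩
    · rw [← h1] at h
      have := hind e (t e + 1) (k + 1) (by omega) (by omega) h
      exact Or.inr ⟨rfl, by omega⟩
  have hne : x ≠ y := by rintro rfl; exact G.loopless.irrefl _ h
  refine (SimpleGraph.fromRel_adj _ _ _).2 ⟨hne, ?_⟩
  rcases x with i | ⟨e, k⟩ <;> rcases y with j | ⟨e', k'⟩
  · exact absurd h (hσσ i j)
  · exact Or.inl (hmixed i e' k' h)
  · exact Or.inr (hmixed j e k h.symm)
  · by_cases hee : e = e'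
    · subst hee
      rcases hind e (k + 1) (k' + 1) (by omega) (by omega) h with h | h
      · exact Or.inl ⟨rfl, by omega⟩
      · exact Or.inr ⟨rfl, by omega⟩
    · exact absurd h (hRR e e' hee _ (hR e (k + 1) (by omega) k.2) _
        (hR e' (k' + 1) (by omega) k'.2))

end subdivMap

/-! ## Shallow topological minors from routed edges -/

/-- The edges of `H` can be routed in `G` with bounded congestion, so that `H` is sparse whenever
the shallow topological minors of `G` are sparse. -/
theorem card_edges_le_of_routing {V : Type} [Fintype V] {G : SimpleGraph V} {l c d : ℕ}
    (hG : ∀ (m : ℕ) (H : SimpleGraph (Fin m)), MemTM l G H → Fintype.card (Edges H) ≤ d * m)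
    {n : ℕ} (H : SimpleGraph (Fin n)) (σ : Fin n → V) (hσ : Function.Injective σ)
    (R : Edges H → Finset V) (hR : ∀ e, (R e).card ≤ l)
    (hc : ∀ v, (Finset.univ.filter fun e => v ∈ R e).card ≤ c)
    (hJ : ∀ e, Joined G {v | v = σ e.1.1 ∨ v = σ e.1.2 ∨ v ∈ R e} (σ e.1.1) (σ e.1.2)) :
    Fintype.card (Edges H) ≤ (2 * (l * c) + 1) * 2 ^ (l + 2) * d * n := by
  obtain ⟨W, T, -, hcard, hT1, hT2⟩ := exists_selection (Finset.univ : Finset (Edges H))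
    (fun e => σ e.1.1) (fun e => σ e.1.2) (fun e => (R e \ {σ e.1.1, σ e.1.2}))
    (fun e => Finset.univ.filter fun e' => ∃ v ∈ R e, v ∈ R e') l (l * c)
    (fun e => (Finset.card_le_card Finset.sdiff_subset).trans (hR e)) (by simp) (by simp) (by
      intro e
      calc _ ≤ ((R e).biUnion fun v => Finset.univ.filter fun e' => v ∈ R e').card := by
            refine Finset.card_le_card fun e' he' => ?_
            simpa using he'
        _ ≤ ∑ v ∈ R e, (Finset.univ.filter fun e' => v ∈ R e').card := Finset.card_biUnion_le
        _ ≤ ∑ v ∈ R e, c := Finset.sum_le_sum fun v _ => hc v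
        _ ≤ l * c := by simpa using Nat.mul_le_mul_right c (hR e))
  obtain ⟨n', hn', H', ι, τ, hτ, hτe, hcard', hends⟩ := exists_graph_of_edges H T
  have hne : ∀ e : Edges H, σ e.1.1 ≠ σ e.1.2 := fun e h => e.2.1.ne (hσ h)
  have hJ' : ∀ e : Edges H, Joined G
      {v | v = σ e.1.1 ∨ v = σ e.1.2 ∨ v ∈ R e \ {σ e.1.1, σ e.1.2}} (σ e.1.1) (σ e.1.2) := by
    intro e
    refine (hJ e).mono fun v hv => ?_
    by_cases h1 : v = σ e.1.1
    · exact Or.inl h1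
    by_cases h2 : v = σ e.1.2
    · exact Or.inr (Or.inl h2)
    rcases hv with hv | hv | hv
    · exact absurd hv h1
    · exact absurd hv h2
    · exact Or.inr (Or.inr (by simp [hv, h1, h2]))
  choose t g ht h0 h1 hadj hinj hgR hind using fun e => exists_induced_path (hne e) (hJ' e)
  have hmem : MemTM l G H' := by
    refine ⟨fun e => t (τ e), fun e => (ht _).trans
      ((Finset.card_le_card Finset.sdiff_subset).trans (hR _)),
      ⟨⟨subdivMap _ (fun i => σ (ι i)) (fun e => g (τ e)), ?_⟩, ?_⟩⟩
    · intro x y hxy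
      refine subdivMap_adj (fun e => ?_) (fun e => ?_) (fun e => hadj (τ e)) hxy
      · rw [h0, (hτe e).1]
      · rw [h1, (hτe e).2.1]
    · refine subdivMap_injective (R := fun e => R (τ e) \ {σ (τ e).1.1, σ (τ e).1.2})
        (hσ.comp ι.injective) (fun e => hinj (τ e)) (fun e => hgR (τ e)) ?_ ?_
      · intro e e' hee
        have := hT2 _ (hτe e).2.2 _ (hτe e').2.2 (hτ.ne hee)
        rw [Finset.disjoint_left]
        intro v hv hv'
        exact this (by
          simp only [Finset.mem_filter, Finset.mem_univ, true_and]
          exact ⟨v, (Finset.mem_sdiff.1 hv).1, (Finset.mem_sdiff.1 hv').1⟩)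
      · intro e i hi
        obtain ⟨f, hf, hif⟩ := hends i
        have hW : σ (ι i) ∈ W := by
          rcases hif with h | h
          · rw [h]; exact (hT1 f hf).1
          · rw [h]; exact (hT1 f hf).2.1
        exact Finset.disjoint_left.1 (hT1 _ (hτe e).2.2).2.2 hi hW
  have h2 := hG n' H' hmem
  rw [hcard'] at h2
  rw [Finset.card_univ] at hcard
  calc _ ≤ _ := hcard
    _ ≤ (2 * (l * c) + 1) * 2 ^ (l + 2) * (d * n) :=
        Nat.mul_le_mul_left _ (h2.trans (Nat.mul_le_mul_left _ hn'))
    _ = _ := by ring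

/-! ## Fraternal augmentations -/

theorem degenerate_of_card_edges_le {V : Type} [Fintype V] {N : SimpleGraph V} {K : ℕ}
    (h : ∀ (n : ℕ) (σ : Fin n → V), Function.Injective σ →
      Fintype.card (Edges (N.comap σ)) ≤ K * n) : Degenerate N (2 * K) := by
  intro U hU
  by_contra! hcon
  set σ : Fin U.card → V := fun i => (U.equivFin.symm i : V) with hσ
  have hσi : Function.Injective σ := Subtype.val_injective.comp U.equivFin.symm.injective
  have h1 := h _ σ hσi
  have hdeg : ∀ i, 2 * K < (N.comap σ).degree i := by
    intro i
    have h2 := hcon (σ i) (U.equivFin.symm i).2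
    rw [← SimpleGraph.card_neighborFinset_eq_degree]
    refine h2.trans_le ?_
    rw [← Finset.card_image_of_injective _ hσi]
    refine Finset.card_le_card fun u hu => ?_
    rw [Finset.mem_filter] at hu
    refine Finset.mem_image.2 ⟨U.equivFin ⟨u, hu.1⟩, ?_, by simp [hσ]⟩
    rw [SimpleGraph.mem_neighborFinset, SimpleGraph.comap_adj]
    simpa [hσ] using hu.2
  have h3 := (N.comap σ).sum_degrees_eq_twice_card_edges
  have h4 : (N.comap σ).edgeFinset.card = Fintype.card (Edges (N.comap σ)) := by
    rw [← ncard_edgeSet, ← SimpleGraph.coe_edgeFinset, Set.ncard_coe_finset]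
  have h5 : ∑ _i : Fin U.card, 2 * K < ∑ i, (N.comap σ).degree i :=
    Finset.sum_lt_sum_of_nonempty
      ⟨⟨0, hU.card_pos⟩, Finset.mem_univ _⟩ fun i _ => hdeg i
  rw [h3, h4] at h5
  simp only [Finset.sum_const, Finset.card_univ, Fintype.card_fin, smul_eq_mul] at h5
  nlinarith

/-- The shallow topological minors of `G` at depth `r` have at most `K r` times as many edges
as vertices. -/
def Sparse {V : Type} (G : SimpleGraph V) (K : ℕ → ℕ) : Prop :=
  ∀ (r m : ℕ) (H : SimpleGraph (Fin m)), MemTM r G H → Fintype.card (Edges H) ≤ K r * m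

/-- The arcs of `D` have bounded in-degree and are routed in `G` by the short connecting sets `R`
with bounded congestion. -/
structure Routed {V : Type} [Fintype V] (G : SimpleGraph V) (D : V → V → Prop)
    (R : Sym2 V → Finset V) (k l c : ℕ) : Prop where
  irrefl : ∀ x, ¬ D x x
  indegree : ∀ y, (Finset.univ.filter fun x => D x y).card ≤ k
  card_le : ∀ x y, D x y → (R s(x, y)).card ≤ l
  joined : ∀ x y, D x y → Joined G {v | v = x ∨ v = y ∨ v ∈ R s(x, y)} x y
  congestion : ∀ v, (Finset.univ.filter fun p : V × V => D p.1 p.2 ∧ v ∈ R s(p.1, p.2)).card ≤ c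

theorem Sparse.exists_routed {V : Type} [Fintype V] {G : SimpleGraph V} {K : ℕ → ℕ}
    (hG : Sparse G K) :
    ∃ (D : V → V → Prop) (R : Sym2 V → Finset V), Routed G D R (2 * (4 * K 0)) 0 0 ∧
      ∀ x y, G.Adj x y → D x y ∨ D y x := by
  have hdeg : Degenerate G (2 * (4 * K 0)) := by
    refine degenerate_of_card_edges_le fun n σ hσ => ?_
    have := card_edges_le_of_routing (l := 0) (c := 0) (hG 0) (G.comap σ) σ hσ (fun _ => ∅)
      (by simp) (by simp) fun e => Joined.of_adj e.2.2 (Or.inl rfl) (Or.inr (Or.inl rfl))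
    simpa using this
  obtain ⟨out, h1, h2, h3⟩ := hdeg.exists_out
  refine ⟨fun x y => x ∈ out y, fun _ => ∅, ⟨fun x hx => G.loopless.irrefl _ (h2 x x hx), ?_,
    by simp, ?_, by simp⟩, fun x y hxy => (h3 x y hxy).symm⟩
  · intro y
    refine le_trans (Finset.card_le_card ?_) (h1 y)
    intro x hx
    simpa using hx
  · intro x y h
    exact Joined.of_adj (h2 y x h).symm (Or.inl rfl) (Or.inr (Or.inl rfl))

/-- The in-degree bound after a fraternal augmentation. -/
def augDegree (k l c d : ℕ) : ℕ :=
  k + 2 * ((2 * ((2 * l + 1) * (k * k + (c * k + c * k))) + 1) * 2 ^ (2 * l + 1 + 2) * d)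

theorem Routed.exists_augmentation {V : Type} [Fintype V] {G : SimpleGraph V} {K : ℕ → ℕ}
    (hG : Sparse G K) {D : V → V → Prop} {R : Sym2 V → Finset V} {k l c : ℕ}
    (h : Routed G D R k l c) :
    ∃ (D' : V → V → Prop) (R' : Sym2 V → Finset V),
      Routed G D' R' (augDegree k l c (K (2 * l + 1))) (2 * l + 1)
        (c + (k * k + (c * k + c * k))) ∧
      (∀ x y, D x y → D' x y) ∧ ∀ x y z, x ≠ y → D x z → D y z → D' x y ∨ D' y x := by
  let N : SimpleGraph V :=
    { Adj := fun x y => x ≠ y ∧ ¬ D x y ∧ ¬ D y x ∧ ∃ z, D x z ∧ D y z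
      symm := ⟨fun x y ⟨h1, h2, h3, z, h4, h5⟩ => ⟨h1.symm, h3, h2, z, h5, h4⟩⟩
      loopless := ⟨fun x hx => hx.1 rfl⟩ }
  have hz : ∀ e : Sym2 V, ∃ (S : Finset V) (z : V) , ∀ x y, e = s(x, y) → N.Adj x y →
      D x z ∧ D y z ∧ S = insert z (R s(x, z) ∪ R s(y, z)) := by
    intro e
    induction e using Sym2.ind with
    | _ a b =>
      by_cases hab : N.Adj a b
      · obtain ⟨z, h4, h5⟩ := hab.2.2.2
        refine ⟨insert z (R s(a, z) ∪ R s(b, z)), z, fun x y hxy _ => ?_⟩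
        rcases Sym2.eq_iff.1 hxy with ⟨rfl, rfl⟩ | ⟨rfl, rfl⟩
        · exact ⟨h4, h5, rfl⟩
        · exact ⟨h5, h4, by rw [Finset.union_comm]⟩
      · refine ⟨∅, a, fun x y hxy h' => ?_⟩
        rcases Sym2.eq_iff.1 hxy with ⟨rfl, rfl⟩ | ⟨rfl, rfl⟩
        · exact absurd h' hab
        · exact absurd h'.symm hab
  choose S z hS using hz
  have hS' : ∀ x y, N.Adj x y → D x (z s(x, y)) ∧ D y (z s(x, y)) ∧
      S s(x, y) = insert (z s(x, y)) (R s(x, z s(x, y)) ∪ R s(y, z s(x, y))) :=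
    fun x y hxy => hS _ x y rfl hxy
  have hScard : ∀ x y, N.Adj x y → (S s(x, y)).card ≤ 2 * l + 1 := by
    intro x y hxy
    obtain ⟨h1, h2, h3⟩ := hS' x y hxy
    rw [h3]
    refine (Finset.card_insert_le _ _).trans ?_
    have := Finset.card_union_le (R s(x, z s(x, y))) (R s(y, z s(x, y)))
    have := h.card_le _ _ h1
    have := h.card_le _ _ h2
    omega
  have hSj : ∀ x y, N.Adj x y → Joined G {v | v = x ∨ v = y ∨ v ∈ S s(x, y)} x y := by
    intro x y hxy
    obtain ⟨h1, h2, h3⟩ := hS' x y hxy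
    refine ((h.joined _ _ h1).mono ?_).trans ((h.joined _ _ h2).mono ?_).symm
    · rintro v (hv | hv | hv)
      · exact Or.inl hv
      · exact Or.inr (Or.inr (by rw [h3, hv]; simp))
      · exact Or.inr (Or.inr (by rw [h3]; simp [hv]))
    · rintro v (hv | hv | hv)
      · exact Or.inr (Or.inl hv)
      · exact Or.inr (Or.inr (by rw [h3, hv]; simp))
      · exact Or.inr (Or.inr (by rw [h3]; simp [hv]))
  have hScong : ∀ v, (Finset.univ.filter fun p : V × V => N.Adj p.1 p.2 ∧
      v ∈ S s(p.1, p.2)).card ≤ k * k + (c * k + c * k) := by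
    intro v
    set In : V → Finset V := fun y => Finset.univ.filter fun x => D x y with hIn
    set A : Finset (V × V) := Finset.univ.filter fun p : V × V => D p.1 p.2 ∧ v ∈ R s(p.1, p.2)
      with hA
    set B : Finset (V × V) := A.biUnion fun p => (In p.2).image fun y => (p.1, y) with hB
    have hBc : B.card ≤ c * k := by
      refine Finset.card_biUnion_le.trans ((Finset.sum_le_sum fun p _ =>
        Finset.card_image_le.trans (h.indegree p.2)).trans ?_)
      simpa using Nat.mul_le_mul_right k (h.congestion v)
    have hsub : (Finset.univ.filter fun p : V × V => N.Adj p.1 p.2 ∧ v ∈ S s(p.1, p.2)) ⊆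
        (In v ×ˢ In v) ∪ (B ∪ B.image Prod.swap) := by
      rintro ⟨x, y⟩ hp
      obtain ⟨hxy, hv⟩ := (Finset.mem_filter.1 hp).2
      simp only at hxy hv
      obtain ⟨h1, h2, h3⟩ := hS' x y hxy
      rw [h3, Finset.mem_insert, Finset.mem_union] at hv
      have hmem : ∀ x y w, D x w → D y w → v ∈ R s(x, w) → (x, y) ∈ B := by
        intro x y w hx hy hv
        refine Finset.mem_biUnion.2 ⟨(x, w), Finset.mem_filter.2 ⟨Finset.mem_univ _, hx, hv⟩, ?_⟩
        exact Finset.mem_image.2 ⟨y, Finset.mem_filter.2 ⟨Finset.mem_univ _, hy⟩, rfl⟩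
      rw [Finset.mem_union, Finset.mem_union]
      rcases hv with hv | hv | hv
      · left
        rw [hv, Finset.mem_product]
        exact ⟨Finset.mem_filter.2 ⟨Finset.mem_univ _, h1⟩,
          Finset.mem_filter.2 ⟨Finset.mem_univ _, h2⟩⟩
      · exact Or.inr (Or.inl (hmem _ _ _ h1 h2 hv))
      · exact Or.inr (Or.inr (Finset.mem_image.2 ⟨(y, x), hmem _ _ _ h2 h1 hv, rfl⟩))
    refine (Finset.card_le_card hsub).trans ((Finset.card_union_le _ _).trans
      (Nat.add_le_add ?_ ((Finset.card_union_le _ _).trans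
        (Nat.add_le_add hBc (Finset.card_image_le.trans hBc)))))
    rw [Finset.card_product]
    exact Nat.mul_le_mul (h.indegree v) (h.indegree v)
  have hdeg : Degenerate N (2 * ((2 * ((2 * l + 1) * (k * k + (c * k + c * k))) + 1) *
      2 ^ (2 * l + 1 + 2) * K (2 * l + 1))) := by
    refine degenerate_of_card_edges_le fun n σ hσ => ?_
    refine card_edges_le_of_routing (hG (2 * l + 1)) (N.comap σ) σ hσ
      (fun e => S s(σ e.1.1, σ e.1.2)) (fun e => hScard _ _ e.2.2) (fun v => ?_)
      (fun e => hSj _ _ e.2.2)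
    refine le_trans ?_ (hScong v)
    refine Finset.card_le_card_of_injOn (fun e => (σ e.1.1, σ e.1.2)) ?_ ?_
    · intro e he
      have := (Finset.mem_filter.1 he).2
      exact Finset.mem_coe.2 (Finset.mem_filter.2 ⟨Finset.mem_univ _, e.2.2, this⟩)
    · intro e _ e' _ hee
      exact Subtype.ext (Prod.ext (hσ (congrArg Prod.fst hee)) (hσ (congrArg Prod.snd hee)))
  obtain ⟨out, h1, h2, h3⟩ := hdeg.exists_out
  have hRN : ∀ x y, D x y → s(x, y) ∉ N.edgeSet := fun x y hxy hN => hN.2.1 hxy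
  have hout : ∀ x y, x ∈ out y → s(x, y) ∈ N.edgeSet := fun x y hxy => (h2 _ _ hxy).symm
  refine ⟨fun x y => D x y ∨ x ∈ out y, fun e => if e ∈ N.edgeSet then S e else R e,
    ⟨?_, ?_, ?_, ?_, ?_⟩, fun x y hxy => Or.inl hxy, ?_⟩
  · rintro x (hx | hx)
    · exact h.irrefl _ hx
    · exact N.loopless.irrefl _ (h2 _ _ hx)
  · intro y
    refine le_trans (Finset.card_le_card (t := (Finset.univ.filter fun x => D x y) ∪ out y) ?_)
      ((Finset.card_union_le _ _).trans (Nat.add_le_add (h.indegree y) (h1 y)))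
    intro x hx
    simpa using hx
  · rintro x y (hxy | hxy)
    · rw [if_neg (hRN x y hxy)]
      have := h.card_le _ _ hxy
      omega
    · rw [if_pos (hout x y hxy)]
      exact hScard _ _ (h2 _ _ hxy).symm
  · rintro x y (hxy | hxy)
    · simp only [if_neg (hRN x y hxy)]
      exact h.joined _ _ hxy
    · simp only [if_pos (hout x y hxy)]
      exact hSj _ _ (h2 _ _ hxy).symm
  · intro v
    refine le_trans (Finset.card_le_card ?_) ((Finset.card_union_le _ _).trans
      (Nat.add_le_add (h.congestion v) (hScong v)))
    rintro ⟨x, y⟩ hp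
    simp only [Finset.mem_filter, Finset.mem_univ, true_and] at hp
    obtain ⟨hp1, hp2⟩ := hp
    rw [Finset.mem_union]
    rcases hp1 with hxy | hxy
    · rw [if_neg (hRN x y hxy)] at hp2
      exact Or.inl (Finset.mem_filter.2 ⟨Finset.mem_univ _, hxy, hp2⟩)
    · rw [if_pos (hout x y hxy)] at hp2
      exact Or.inr (Finset.mem_filter.2 ⟨Finset.mem_univ _, (h2 _ _ hxy).symm, hp2⟩)
  · intro x y w hne hx hy
    by_cases hxy : D x y
    · exact Or.inl (Or.inl hxy)
    by_cases hyx : D y x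
    · exact Or.inr (Or.inl hyx)
    rcases h3 x y ⟨hne, hxy, hyx, w, hx, hy⟩ with h | h
    · exact Or.inr (Or.inr h)
    · exact Or.inl (Or.inr h)

/-! ## Centered colorings -/

/-- There is a directed walk of at most `n` steps from `u` to `v`. -/
def Reach {V : Type} (D : V → V → Prop) : ℕ → V → V → Prop
  | 0, u, v => u = v
  | n + 1, u, v => ∃ w, Reach D n u w ∧ (w = v ∨ D w v)

theorem Reach.succ {V : Type} {D : V → V → Prop} {n : ℕ} {u v : V} (h : Reach D n u v) :
    Reach D (n + 1) u v := ⟨v, h, Or.inl rfl⟩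

theorem card_reach_le {V : Type} [Fintype V] {D : V → V → Prop} {k : ℕ}
    (h : ∀ y, (Finset.univ.filter fun x => D x y).card ≤ k) (n : ℕ) (v : V) :
    (Finset.univ.filter fun u => Reach D n u v).card ≤ (k + 1) ^ n := by
  induction n generalizing v with
  | zero =>
    rw [pow_zero]
    refine Finset.card_le_one.2 fun a ha b hb => ?_
    exact (Finset.mem_filter.1 ha).2.trans (Finset.mem_filter.1 hb).2.symm
  | succ n ih =>
    have hsub : (Finset.univ.filter fun u => Reach D (n + 1) u v) ⊆
        (insert v (Finset.univ.filter fun x => D x v)).biUnion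
          fun w => Finset.univ.filter fun u => Reach D n u w := by
      intro u hu
      obtain ⟨w, hw, hwv⟩ := (Finset.mem_filter.1 hu).2
      refine Finset.mem_biUnion.2 ⟨w, ?_, Finset.mem_filter.2 ⟨Finset.mem_univ _, hw⟩⟩
      simpa using hwv
    calc _ ≤ _ := Finset.card_le_card hsub
      _ ≤ _ := Finset.card_biUnion_le
      _ ≤ ∑ w ∈ insert v (Finset.univ.filter fun x => D x v), (k + 1) ^ n :=
        Finset.sum_le_sum fun w _ => ih w
      _ ≤ (k + 1) ^ (n + 1) := by
        rw [Finset.sum_const, smul_eq_mul, pow_succ, mul_comm]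
        exact Nat.mul_le_mul_left _ ((Finset.card_insert_le _ _).trans
          (Nat.add_le_add_right (h v) 1))

theorem exists_remove_of_arc {V : Type} {D D' : V → V → Prop} (hD : ∀ x y, D x y → D' x y)
    (hfrat : ∀ x y z, x ≠ y → D x z → D y z → D' x y ∨ D' y x) (l : List V) (x y : V)
    (hxy : D x y) (hl : (x :: y :: l).IsChain fun a b => D a b ∨ D b a)
    (hnd : (x :: y :: l).Nodup) :
    ∃ (l' : List V) (z w : V), ((x :: l').IsChain fun a b => D' a b ∨ D' b a) ∧
      (x :: y :: l).Perm (z :: x :: l') ∧ w ∈ x :: l' ∧ D w z := by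
  induction l generalizing x y with
  | nil => exact ⟨[], y, x, by simp, List.Perm.swap _ _ _, by simp, hxy⟩
  | cons z l ih =>
    have hl1 := (List.isChain_cons_cons.1 hl).2
    have hl2 := List.isChain_cons_cons.1 hl1
    by_cases hyz : D y z
    · obtain ⟨l', z', w, h1, h2, h3, h4⟩ := ih y z hyz hl1 (List.nodup_cons.1 hnd).2
      refine ⟨y :: l', z', w, List.isChain_cons_cons.2 ⟨Or.inl (hD _ _ hxy), h1⟩, ?_,
        List.mem_cons_of_mem _ h3, h4⟩
      exact (h2.cons x).trans (List.Perm.swap _ _ _)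
    · have hzy : D z y := hl2.1.resolve_left hyz
      refine ⟨z :: l, y, x, List.isChain_cons_cons.2 ⟨?_, ?_⟩, List.Perm.swap _ _ _, by simp, hxy⟩
      · refine hfrat x z y ?_ hxy hzy
        rintro rfl
        simp at hnd
      · exact hl2.2.imp fun a b h => h.imp (hD _ _) (hD _ _)

theorem exists_remove {V : Type} {D D' : V → V → Prop} (hD : ∀ x y, D x y → D' x y)
    (hfrat : ∀ x y z, x ≠ y → D x z → D y z → D' x y ∨ D' y x) (l : List V) (x y : V)
    (hl : (x :: y :: l).IsChain fun a b => D a b ∨ D b a) (hnd : (x :: y :: l).Nodup) :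
    ∃ (l' : List V) (z w : V), (l'.IsChain fun a b => D' a b ∨ D' b a) ∧
      (x :: y :: l).Perm (z :: l') ∧ w ∈ l' ∧ D w z := by
  rcases (List.isChain_cons_cons.1 hl).1 with h | h
  · obtain ⟨l', z, w, h'⟩ := exists_remove_of_arc hD hfrat l x y h hl hnd
    exact ⟨_, z, w, h'⟩
  · exact ⟨y :: l, x, y, (List.isChain_cons_cons.1 hl).2.imp fun a b h => h.imp (hD _ _) (hD _ _),
      List.Perm.refl _, by simp, h⟩

theorem exists_center (K : ℕ → ℕ) (j k l c : ℕ) :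
    ∃ k', ∀ {V : Type} [Fintype V] {G : SimpleGraph V}, Sparse G K →
      ∀ (D : V → V → Prop) (R : Sym2 V → Finset V), Routed G D R k l c →
      ∃ D' : V → V → Prop, (∀ y, (Finset.univ.filter fun x => D' x y).card ≤ k') ∧
        (∀ x y, D x y → D' x y) ∧
        ∀ p : List V, p ≠ [] → (p.IsChain fun a b => D a b ∨ D b a) → p.Nodup →
          p.length ≤ j + 1 → ∃ u ∈ p, ∀ v ∈ p, Reach D' j u v := by
  induction j generalizing k l c with
  | zero =>
    refine ⟨k, fun {V} _ {G} hG D R h => ⟨D, h.indegree, fun _ _ h => h, fun p hp _ _ hlen => ?_⟩⟩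
    match p, hp, hlen with
    | [u], _, _ => exact ⟨u, by simp, by simp [Reach]⟩
    | _ :: _ :: _, _, hlen => simp at hlen
  | succ j ih =>
    obtain ⟨k', hk'⟩ := ih (augDegree k l c (K (2 * l + 1))) (2 * l + 1)
      (c + (k * k + (c * k + c * k)))
    refine ⟨k', fun {V} _ {G} hG D R h => ?_⟩
    obtain ⟨D1, R1, h1, hD, hfrat⟩ := h.exists_augmentation hG
    obtain ⟨D2, hin, hD2, hcen⟩ := hk' hG D1 R1 h1
    refine ⟨D2, hin, fun x y hxy => hD2 _ _ (hD _ _ hxy), fun p hp hchain hnd hlen => ?_⟩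
    match p, hp, hchain, hnd, hlen with
    | [u], _, _, _, _ => exact ⟨u, by simp, fun v hv => by
        obtain rfl : v = u := by simpa using hv
        clear * -
        generalize j + 1 = n
        induction n with
        | zero => rfl
        | succ n ih => exact ih.succ⟩
    | x :: y :: p, _, hchain, hnd, hlen =>
      obtain ⟨p', z, w, hc', hperm, hw, hwz⟩ := exists_remove hD hfrat p x y hchain hnd
      have hlen' := hperm.length_eq
      simp only [List.length_cons] at hlen hlen'
      obtain ⟨u, hu, hreach⟩ := hcen p' (List.ne_nil_of_mem hw) hc'
        (List.nodup_cons.1 (hperm.nodup_iff.1 hnd)).2 (by omega)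
      refine ⟨u, hperm.mem_iff.2 (List.mem_cons_of_mem _ hu), fun v hv => ?_⟩
      rcases List.mem_cons.1 (hperm.mem_iff.1 hv) with rfl | hv
      · exact ⟨w, hreach w hw, Or.inr (hD2 _ _ (hD _ _ hwz))⟩
      · exact (hreach v hv).succ

/-- Sparse graphs have colorings with boundedly many colors in which every short path has a
vertex of unique color. -/
theorem exists_centered_coloring (K : ℕ → ℕ) (L : ℕ) :
    ∃ N, ∀ {V : Type} [Fintype V] {G : SimpleGraph V}, Sparse G K → ∃ c : V → Fin N,
      ∀ p : List V, p ≠ [] → p.IsChain G.Adj → p.Nodup → p.length ≤ L →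
        ∃ u ∈ p, ∀ v ∈ p, c v = c u → v = u := by
  obtain ⟨k, hk⟩ := exists_center K L (2 * (4 * K 0)) 0 0
  refine ⟨2 * (k + 1) ^ L + 1, fun {V} _ {G} hG => ?_⟩
  obtain ⟨D, R, h, hadj⟩ := hG.exists_routed
  obtain ⟨D', hin, -, hcen⟩ := hk hG D R h
  obtain ⟨c, hc⟩ := exists_coloring_of_out
    (fun v => Finset.univ.filter fun u => Reach D' L u v) (card_reach_le hin L)
  refine ⟨c, fun p hp hchain hnd hlen => ?_⟩
  obtain ⟨u, hu, hr⟩ := hcen p hp (hchain.imp hadj) hnd (by omega)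
  refine ⟨u, hu, fun v hv hcv => ?_⟩
  by_contra hne
  exact hc v u hne (Finset.mem_filter.2 ⟨Finset.mem_univ _, hr v hv⟩) hcv

/-! ## Elimination forests -/

theorem length_lt_of_centered {V α : Type} {G : SimpleGraph V} {c : V → α} {L : ℕ}
    (hc : ∀ p : List V, p ≠ [] → p.IsChain G.Adj → p.Nodup → p.length ≤ L →
      ∃ u ∈ p, ∀ v ∈ p, c v = c u → v = u) (I : Finset α) (hI : 2 ^ I.card ≤ L)
    (p : List V) (hp : p.IsChain G.Adj) (hnd : p.Nodup) (hpI : ∀ v ∈ p, c v ∈ I) :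
    p.length < 2 ^ I.card := by
  induction hq : I.card generalizing I p with
  | zero =>
    rw [Finset.card_eq_zero] at hq
    subst hq
    match p, hpI with
    | [], _ => simp
    | u :: _, hpI => exact absurd (hpI u (by simp)) (by simp)
  | succ q ih =>
    by_contra! hlong
    have hlen : (p.take (2 ^ (q + 1))).length = 2 ^ (q + 1) := by simpa using hlong
    have hchain := hp.take (2 ^ (q + 1))
    have hnd' := hnd.sublist (List.take_sublist (2 ^ (q + 1)) p)
    have hmem : ∀ v ∈ p.take (2 ^ (q + 1)), c v ∈ I := fun v hv => hpI v (List.mem_of_mem_take hv)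
    generalize p.take (2 ^ (q + 1)) = p' at hlen hchain hnd' hmem
    have hpos : 0 < 2 ^ q := Nat.two_pow_pos q
    rw [hq] at hI
    obtain ⟨u, hu, huniq⟩ := hc p'
      (by rintro rfl; exact absurd hlen (Nat.two_pow_pos (q + 1)).ne) hchain hnd' (by omega)
    obtain ⟨l₁, l₂, rfl⟩ := List.append_of_mem hu
    have hcard : (I.erase (c u)).card = q := by
      rw [Finset.card_erase_of_mem (hmem u hu), hq]
      rfl
    have hsub : ∀ l : List V, l.Sublist (l₁ ++ u :: l₂) → u ∉ l → l.IsChain G.Adj →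
        l.length < 2 ^ q := by
      intro l hl hul hlc
      have hqL : 2 ^ (I.erase (c u)).card ≤ L := by
        rw [hcard, pow_succ] at *
        omega
      refine ih (I.erase (c u)) hqL l hlc (hnd'.sublist hl) (fun v hv => ?_) hcard
      refine Finset.mem_erase.2 ⟨fun h => hul ?_, hmem v (hl.subset hv)⟩
      rw [← huniq v (hl.subset hv) h]
      exact hv
    have hnd2 := List.nodup_append.1 hnd'
    have h1 := hsub l₁ (List.sublist_append_left _ _)
      (fun h => hnd2.2.2 u h u (by simp) rfl) hchain.left_of_append
    have h2 := hsub l₂ ((List.sublist_cons_self _ _).trans (List.sublist_append_right _ _))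
      (List.nodup_cons.1 hnd2.2.1).1 hchain.right_of_append.tail
    simp only [List.length_append, List.length_cons] at hlen
    rw [pow_succ] at hlen
    omega

/-- The subgraph of `G` induced by `S` has an elimination forest of height at most `q`. -/
def TD {V : Type} (G : SimpleGraph V) : ℕ → Set V → Prop
  | 0, S => S = ∅
  | q + 1, S => ∃ root : V → V, (∀ v ∈ S, root v ∈ S) ∧
      (∀ u ∈ S, ∀ v ∈ S, G.Adj u v → root u = root v) ∧
      ∀ z, TD G q ({v ∈ S | root v = z} \ {z})

theorem Joined.exists_neighbor {V : Type} {G : SimpleGraph V} {S : Set V} {z v : V}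
    (h : Joined G S z v) (hne : z ≠ v) : ∃ r, G.Adj z r ∧ Joined G (S \ {z}) r v := by
  obtain ⟨p, hp⟩ := h
  have hb := p.bypass_isPath
  have hs : ∀ w ∈ p.bypass.support, w ∈ S := fun w hw => hp w (p.support_bypass_subset_support hw)
  generalize p.bypass = p' at hb hs
  cases p' with
  | nil => exact absurd rfl hne
  | cons hadj p'' =>
    refine ⟨_, hadj, p'', fun w hw => ⟨hs w (by simp [hw]), ?_⟩⟩
    rintro rfl
    exact ((SimpleGraph.Walk.cons_isPath_iff _ _).1 hb).2 hw

theorem Joined.of_mem_support {V : Type} {G : SimpleGraph V} {S : Set V} {x y w : V}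
    (p : G.Walk x y) (hp : ∀ v ∈ p.support, v ∈ S) (hw : w ∈ p.support) : Joined G S x w :=
  ⟨p.takeUntil w hw, fun v hv => hp v (p.support_takeUntil_subset_support hw hv)⟩

/-- Every path of `G` inside `S` that starts at `r` has at most `m` vertices. -/
def ShortFrom {V : Type} (G : SimpleGraph V) (S : Set V) (m : ℕ) (r : V) : Prop :=
  ∀ l : List V, (r :: l).IsChain G.Adj → (r :: l).Nodup → (∀ x ∈ r :: l, x ∈ S) →
    (r :: l).length ≤ m

theorem td_of_shortFrom {V : Type} {G : SimpleGraph V} (m : ℕ) (S : Set V)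
    (h : ∀ v ∈ S, ∃ r, Joined G S r v ∧ ShortFrom G S m r) : TD G m S := by
  induction m generalizing S with
  | zero =>
    refine Set.eq_empty_of_forall_notMem fun v hv => ?_
    obtain ⟨r, ⟨p, hp⟩, hr⟩ := h v hv
    have := hr [] (by simp) (by simp) (by simpa using hp r p.start_mem_support)
    simp at this
  | succ m ih =>
    rcases isEmpty_or_nonempty V with hV | ⟨⟨v₀⟩⟩
    · exact ⟨id, isEmptyElim, isEmptyElim, isEmptyElim⟩
    set comp : V → Set V := fun v => {r | Joined G S v r} with hcomp
    have hcomp_eq : ∀ u v, Joined G S u v → comp u = comp v := by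
      intro u v huv
      ext r
      exact ⟨fun hr => huv.symm.trans hr, fun hr => huv.trans hr⟩
    have hchoice : ∀ A : Set V, ∃ r, (∃ s ∈ A, ShortFrom G S (m + 1) s) →
        r ∈ A ∧ ShortFrom G S (m + 1) r := by
      intro A
      by_cases hA : ∃ s ∈ A, ShortFrom G S (m + 1) s
      · obtain ⟨s, hs⟩ := hA
        exact ⟨s, fun _ => hs⟩
      · exact ⟨v₀, fun h => absurd h hA⟩
    choose f hf using hchoice
    have hroot : ∀ v ∈ S, Joined G S v (f (comp v)) ∧ ShortFrom G S (m + 1) (f (comp v)) := by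
      intro v hv
      obtain ⟨r, hr1, hr2⟩ := h v hv
      exact hf (comp v) ⟨r, hr1.symm, hr2⟩
    refine ⟨fun v => f (comp v), fun v hv => ?_, fun u hu v hv huv => ?_, fun z => ih _ ?_⟩
    · obtain ⟨p, hp⟩ := (hroot v hv).1
      exact hp _ p.end_mem_support
    · exact congrArg f (hcomp_eq u v (Joined.of_adj huv hu hv))
    · rintro v ⟨⟨hvS, hvz⟩, hne⟩
      have hz := hroot v hvS
      simp only at hvz
      rw [hvz] at hz
      obtain ⟨r, hzr, p, hp⟩ := hz.1.symm.exists_neighbor (fun h => hne h.symm)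
      have hzS : z ∈ S := by
        obtain ⟨p, hp⟩ := hz.1
        exact hp _ p.end_mem_support
      have hrS : r ∈ S := (hp r p.start_mem_support).1
      refine ⟨r, ⟨p, fun w hw => ⟨⟨(hp w hw).1, ?_⟩, (hp w hw).2⟩⟩, fun l hl hnd hlS => ?_⟩
      · have hzw : Joined G S z w := (Joined.of_adj hzr hzS hrS).trans
          (Joined.of_mem_support p (fun v hv => (hp v hv).1) hw)
        simp only
        rw [← hcomp_eq v w (hz.1.trans hzw), hvz]
      · have := hz.2 (r :: l) (List.isChain_cons_cons.2 ⟨hzr, hl⟩)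
          (List.nodup_cons.2 ⟨fun h => (hlS z h).2 rfl, hnd⟩)
          (by
            intro x hx
            rcases List.mem_cons.1 hx with rfl | hx
            · exact hzS
            · exact (hlS x hx).1.1)
        simpa using this

/-! ## Finite families of retracts -/

/-- A digraph with labelled vertices. -/
structure LabDigraph (Λ : Type) where
  V : Type
  lab : V → Λ
  arc : V → V → Prop

/-- The arc relation of the disjoint union of a family of digraphs. -/
inductive SigmaArc {ι Λ : Type} (B : ι → LabDigraph Λ) :
    (Σ i, (B i).V) → (Σ i, (B i).V) → Prop
  | mk (i : ι) (x y : (B i).V) : (B i).arc x y → SigmaArc B ⟨i, x⟩ ⟨i, y⟩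

theorem SigmaArc.restrict {ι Λ : Type} {B : ι → LabDigraph Λ} {x y : Σ i, (B i).V}
    (h : SigmaArc B x y) (s : Set ι) (hx : x.1 ∈ s) (hy : y.1 ∈ s) :
    SigmaArc (fun i : s => B i) ⟨⟨x.1, hx⟩, x.2⟩ ⟨⟨y.1, hy⟩, y.2⟩ := by
  cases h with
  | mk i x y h => exact SigmaArc.mk (B := fun i : s => B i) ⟨i, hx⟩ x y h

/-- The disjoint union of a subfamily with an additional vertex. -/
def coneDigraph {ι Λ : Type} (B : ι → LabDigraph (Λ × Prop × Prop)) (s : Set ι) (a : Λ) :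
    LabDigraph Λ where
  V := Option (Σ i : s, (B i).V)
  lab := fun x => x.elim a fun y => ((B y.1).lab y.2).1
  arc := fun x y => match x, y with
    | none, none => False
    | none, some y => ((B y.1).lab y.2).2.1
    | some x, none => ((B x.1).lab x.2).2.2
    | some x, some y => SigmaArc (fun i : s => B i) x y

theorem exists_retract_family (q : ℕ) (Λ : Type) [Finite Λ] :
    ∃ (ι : Type) (_ : Finite ι) (B : ι → LabDigraph Λ), (∀ i, Finite (B i).V) ∧
      ∀ {V : Type} {G : SimpleGraph V} (lab : V → Λ) (arc : V → V → Prop) (S : Set V),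
        (∀ x y, arc x y → G.Adj x y) → TD G q S →
        ∃ g : S → Σ i, (B i).V, (∀ x, (B (g x).1).lab (g x).2 = lab x) ∧
          (∀ x y : S, arc x y → SigmaArc B (g x) (g y)) ∧
          ∀ x : S, ∃ φ : (B (g x).1).V → V, (∀ b, φ b ∈ S) ∧
            (∀ b, lab (φ b) = (B (g x).1).lab b) ∧
            ∀ b b', (B (g x).1).arc b b' → arc (φ b) (φ b') := by
  induction q generalizing Λ with
  | zero =>
    refine ⟨Empty, inferInstance, Empty.elim, fun i => i.elim, fun {V} {G} lab arc S _ hS => ?_⟩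
    have : IsEmpty S := by
      rw [show S = ∅ from hS]
      infer_instance
    exact ⟨isEmptyElim, isEmptyElim, isEmptyElim, isEmptyElim⟩
  | succ q ih =>
    obtain ⟨ι, hι, B, hB, H⟩ := ih (Λ × Prop × Prop)
    refine ⟨Set ι × Λ, inferInstance, fun i => coneDigraph B i.1 i.2, fun i => ?_,
      fun {V} {G} lab arc S harc hS => ?_⟩
    · have : Finite (Option (Σ j : i.1, (B j).V)) := inferInstance
      exact this
    obtain ⟨root, hr1, hr2, hr3⟩ := hS
    choose g hg1 hg2 φ hφ1 hφ2 hφ3 using fun z =>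
      H (G := G) (fun v => (lab v, arc z v, arc v z)) arc _ harc (hr3 z)
    set U : V → Set ι := fun z => Set.range fun x => (g z x).1 with hU
    have hmem : ∀ (v : S), (v : V) ≠ root v →
        (v : V) ∈ {w ∈ S | root w = root v} \ {root v} := fun v hv => ⟨⟨v.2, rfl⟩, hv⟩
    have hdec : ∀ v : S, ∃ x : (coneDigraph B (U (root v)) (lab (root v))).V,
        ((v : V) = root v → x = none) ∧ ∀ h : (v : V) ≠ root v,
          x = some ⟨⟨(g (root v) ⟨v, hmem v h⟩).1, ⟨_, rfl⟩⟩, (g (root v) ⟨v, hmem v h⟩).2⟩ := by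
      intro v
      by_cases h : (v : V) = root v
      · exact ⟨none, fun _ => rfl, fun h' => absurd h h'⟩
      · exact ⟨some ⟨⟨(g (root v) ⟨v, hmem v h⟩).1, ⟨_, rfl⟩⟩, (g (root v) ⟨v, hmem v h⟩).2⟩,
          fun h' => absurd h' h, fun _ => rfl⟩
    choose x hx1 hx2 using hdec
    refine ⟨fun v => ⟨(U (root v), lab (root v)), x v⟩, fun v => ?_, fun v w hvw => ?_, fun v => ?_⟩
    · by_cases h : (v : V) = root v
      · simp only [hx1 v h]
        exact congrArg lab h.symm
      · simp only [hx2 v h]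
        exact congrArg Prod.fst (hg1 (root v) ⟨v, hmem v h⟩)
    · have hroot := hr2 v v.2 w w.2 (harc _ _ hvw)
      have hspec : ∀ (z : V) (v : S), root v = z →
          ∃ y : (coneDigraph B (U z) (lab z)).V,
            (⟨(U (root v), lab (root v)), x v⟩ :
              Σ i : Set ι × Λ, (coneDigraph B i.1 i.2).V) = ⟨(U z, lab z), y⟩ ∧
            ((v : V) = z ∧ y = none ∨ ∃ h : (v : V) ∈ {w ∈ S | root w = z} \ {z},
              y = some ⟨⟨(g z ⟨v, h⟩).1, ⟨_, rfl⟩⟩, (g z ⟨v, h⟩).2⟩) := by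
        rintro _ v rfl
        refine ⟨x v, rfl, ?_⟩
        by_cases h : (v : V) = root v
        · exact Or.inl ⟨h, hx1 v h⟩
        · exact Or.inr ⟨hmem v h, hx2 v h⟩
      obtain ⟨y, hy, hyv⟩ := hspec (root w) v hroot
      obtain ⟨y', hy', hyw⟩ := hspec (root w) w rfl
      beta_reduce
      rw [hy, hy']
      refine SigmaArc.mk (B := fun i : Set ι × Λ => coneDigraph B i.1 i.2) _ _ _ ?_
      rcases hyv with ⟨hv, rfl⟩ | ⟨hv, rfl⟩ <;> rcases hyw with ⟨hw, rfl⟩ | ⟨hw, rfl⟩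
      · exact absurd (harc _ _ hvw) (by rw [hv, ← hw]; exact G.loopless.irrefl _)
      · have h := congrArg (fun l => l.2.1) (hg1 _ ⟨_, hw⟩)
        exact h.mpr (hv ▸ hvw : arc (root w) w)
      · have h := congrArg (fun l => l.2.2) (hg1 _ ⟨_, hv⟩)
        exact h.mpr (hw ▸ hvw : arc v (root w))
      · exact (hg2 (root w) ⟨v, hv⟩ ⟨w, hw⟩ hvw).restrict _ _ _
    · have hψ : ∀ i : U (root v), ∃ ψ : (B i).V → V,
          (∀ b, ψ b ∈ {w ∈ S | root w = root v} \ {root v}) ∧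
          (∀ b, (lab (ψ b), arc (root v) (ψ b), arc (ψ b) (root v)) = (B i).lab b) ∧
          ∀ b b', (B i).arc b b' → arc (ψ b) (ψ b') := by
        rintro ⟨_, y, rfl⟩
        exact ⟨φ _ y, hφ1 _ y, hφ2 _ y, hφ3 _ y⟩
      choose ψ hψ1 hψ2 hψ3 using hψ
      refine ⟨fun b => Option.elim b (root v) fun y => ψ y.1 y.2, ?_, ?_, ?_⟩
      · rintro (_ | y)
        · exact hr1 v v.2
        · exact (hψ1 y.1 y.2).1.1
      · rintro (_ | y)
        · rfl
        · exact congrArg Prod.fst (hψ2 y.1 y.2)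
      · rintro (_ | y) (_ | y') h
        · exact h.elim
        · exact (congrArg (fun l => l.2.1) (hψ2 y'.1 y'.2)).mpr h
        · exact (congrArg (fun l => l.2.2) (hψ2 y.1 y.2)).mpr h
        · cases h with
          | mk i x y h => exact hψ3 i x y h

/-! ## Graphs without a given acyclic pattern have bounded clique number -/

theorem exists_pairwise_of_tournament {V : Type} {A : V → V → Prop} (k : ℕ) (S : Finset V)
    (hS : ∀ x ∈ S, ∀ y ∈ S, x ≠ y → A x y ∨ A y x) (hk : 2 ^ k ≤ S.card) :
    ∃ l : List V, l.Pairwise A ∧ l.length = k ∧ ∀ x ∈ l, x ∈ S := by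
  induction k generalizing S with
  | zero => exact ⟨[], by simp⟩
  | succ k ih =>
    have hpos : 0 < 2 ^ k := Nat.two_pow_pos k
    rw [pow_succ] at hk
    obtain ⟨x, hx⟩ : S.Nonempty := Finset.card_pos.1 (by omega)
    have hcard := Finset.card_erase_of_mem hx
    have hunion : S.erase x ⊆ S.filter (A x) ∪ S.filter fun y => A y x := by
      intro y hy
      obtain ⟨h1, h2⟩ := Finset.mem_erase.1 hy
      rcases hS x hx y h2 (Ne.symm h1) with h | h
      · exact Finset.mem_union_left _ (Finset.mem_filter.2 ⟨h2, h⟩)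
      · exact Finset.mem_union_right _ (Finset.mem_filter.2 ⟨h2, h⟩)
    have hle := (Finset.card_le_card hunion).trans (Finset.card_union_le _ _)
    have hsub : ∀ P : V → Prop, ∀ y ∈ S.filter P, y ∈ S := fun P y hy =>
      (Finset.mem_filter.1 hy).1
    rcases le_or_gt (2 ^ k) (S.filter (A x)).card with h | h
    · obtain ⟨l, h1, h2, h3⟩ := ih (S.filter (A x))
        (fun y hy z hz => hS y (hsub _ y hy) z (hsub _ z hz)) h
      refine ⟨x :: l, List.pairwise_cons.2 ⟨fun y hy => (Finset.mem_filter.1 (h3 y hy)).2, h1⟩,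
        by simp [h2], ?_⟩
      rintro y hy
      rcases List.mem_cons.1 hy with rfl | hy
      · exact hx
      · exact hsub _ y (h3 y hy)
    · obtain ⟨l, h1, h2, h3⟩ := ih (S.filter fun y => A y x)
        (fun y hy z hz => hS y (hsub _ y hy) z (hsub _ z hz)) (by omega)
      refine ⟨l ++ [x], List.pairwise_append.2 ⟨h1, by simp, fun y hy z hz => ?_⟩,
        by simp [h2], ?_⟩
      · rw [List.mem_singleton.1 hz]
        exact (Finset.mem_filter.1 (h3 y hy)).2
      · intro y hy
        rcases List.mem_append.1 hy with hy | hy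
        · exact hsub _ y (h3 y hy)
        · rw [List.mem_singleton.1 hy]
          exact hx

theorem exists_hom_of_pairwise {V : Type} {A : V → V → Prop} {p : ℕ} {F : Fin p → Fin p → Prop}
    (hF : IsAcyclicDigraph F) (l : List V) (hl : l.Pairwise A) (hlen : l.length = p) :
    ∃ f : Fin p → V, ∀ u v, F u v → A (f u) (f v) := by
  set ht : Fin p → ℕ := fun v => (Finset.univ.filter fun u => Relation.TransGen F u v).card
  have hlt : ∀ v, ht v < l.length := by
    intro v
    have : (Finset.univ.filter fun u => Relation.TransGen F u v).card < Fintype.card (Fin p) :=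
      Finset.card_lt_univ_of_notMem (x := v) (by simpa using hF v)
    rw [Fintype.card_fin] at this
    rw [hlen]
    exact this
  refine ⟨fun v => l[ht v]'(hlt v), fun u v huv => ?_⟩
  refine List.pairwise_iff_getElem.1 hl _ _ _ _ ?_
  refine Finset.card_lt_card ((Finset.ssubset_iff_of_subset fun w hw => ?_).2 ⟨u, ?_, ?_⟩)
  · exact Finset.mem_filter.2 ⟨Finset.mem_univ _, (Finset.mem_filter.1 hw).2.tail huv⟩
  · exact Finset.mem_filter.2 ⟨Finset.mem_univ _, Relation.TransGen.single huv⟩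
  · simpa using hF u

theorem omegaNum_mem {V : Type} {G : SimpleGraph V} {b : ℕ}
    (h : ∀ m, IsSubgraphOf (⊤ : SimpleGraph (Fin m)) G → m ≤ b) :
    IsSubgraphOf (⊤ : SimpleGraph (Fin (omegaNum G))) G :=
  Nat.sSup_mem (s := {m | IsSubgraphOf (⊤ : SimpleGraph (Fin m)) G})
    ⟨0, ⟨⟨Fin.elim0, fun {a} => a.elim0⟩, fun a => a.elim0⟩⟩ ⟨b, h⟩

theorem omegaNum_lt_of_not_hom {n p : ℕ} {G : SimpleGraph (Fin n)} {A : Fin n → Fin n → Prop}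
    (hA : IsOrientationOf A G) {F : Fin p → Fin p → Prop} (hF : IsAcyclicDigraph F)
    (h : ¬ DigraphHomEx F A) : omegaNum G < 2 ^ p := by
  have key : ∀ m, IsSubgraphOf (⊤ : SimpleGraph (Fin m)) G → m < 2 ^ p := by
    rintro m ⟨f, hf⟩
    by_contra! hm
    obtain ⟨l, h1, h2, -⟩ := exists_pairwise_of_tournament (A := A) p (Finset.univ.image f)
      (by
        intro x hx y hy hxy
        obtain ⟨i, -, rfl⟩ := Finset.mem_image.1 hx
        obtain ⟨j, -, rfl⟩ := Finset.mem_image.1 hy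
        exact (hA.2 _ _).1 (f.map_adj (show i ≠ j from fun h => hxy (by rw [h]))))
      (by rwa [Finset.card_image_of_injective _ hf, Finset.card_univ, Fintype.card_fin])
    exact h (exists_hom_of_pairwise hF l h1 h2)
  exact key _ (omegaNum_mem fun m hm => (key m hm).le)

theorem exists_sparse_of_omegaBoundedExpansion {C : GraphClass} (h : OmegaBoundedExpansion C)
    (b : ℕ) : ∃ K : ℕ → ℕ, ∀ ⦃n : ℕ⦄ (G : SimpleGraph (Fin n)), G ∈ C n → omegaNum G < b →
      Sparse G K := by
  obtain ⟨f, hf⟩ := h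
  refine ⟨fun r => ∑ w ∈ Finset.range b, ⌈f w r⌉₊, fun n G hG hb r m H hH => ?_⟩
  refine (card_edges_le_of_avgDeg_le (hf G hG r H hH)).trans (Nat.mul_le_mul_right _ ?_)
  exact Finset.single_le_sum (f := fun w => ⌈f w r⌉₊) (fun _ _ => Nat.zero_le _)
    (Finset.mem_range.2 hb)

/-! ## Construction of the dual -/

theorem SigmaArc.arc_of_eq {ι Λ : Type} {B : ι → LabDigraph Λ} {i : ι} {x y : (B i).V}
    (h : SigmaArc B ⟨i, x⟩ ⟨i, y⟩) : (B i).arc x y := by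
  cases h with
  | mk _ _ _ h => exact h

theorem SigmaArc.fst_eq {ι Λ : Type} {B : ι → LabDigraph Λ} {x y : Σ i, (B i).V}
    (h : SigmaArc B x y) : x.1 = y.1 := by
  cases h
  rfl

/-- A connected digraph maps to a disjoint union only if it maps to one of the parts. -/
theorem exists_hom_of_sigmaArc {ι Λ : Type} {B : ι → LabDigraph Λ} {p : ℕ}
    {F : Fin p → Fin p → Prop} (hF : (SimpleGraph.fromRel F).Connected)
    (g : Fin p → Σ i, (B i).V) (hg : ∀ u v, F u v → SigmaArc B (g u) (g v)) :
    ∃ i, ∃ f : Fin p → (B i).V, ∀ u v, F u v → (B i).arc (f u) (f v) := by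
  obtain ⟨u₀⟩ := hF.nonempty
  have hw : ∀ u v (_ : (SimpleGraph.fromRel F).Walk u v), (g u).1 = (g v).1 := by
    intro u v w
    induction w with
    | nil => rfl
    | cons h _ ih =>
      rw [← ih]
      rcases ((SimpleGraph.fromRel_adj _ _ _).1 h).2 with h | h
      · exact (hg _ _ h).fst_eq
      · exact (hg _ _ h).fst_eq.symm
  have hb : ∀ u, ∃ b : (B (g u₀).1).V, g u = ⟨(g u₀).1, b⟩ := by
    intro u
    obtain ⟨w⟩ := hF.preconnected u₀ u
    have := hw _ _ w
    generalize (g u₀).1 = i at this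
    subst this
    exact ⟨_, rfl⟩
  choose f hf using hb
  refine ⟨_, f, fun u v huv => ?_⟩
  have := hg u v huv
  rw [hf u, hf v] at this
  exact this.arc_of_eq

theorem hasRestrictedDual_of_omegaBoundedExpansion {C : GraphClass} (hC : OmegaBoundedExpansion C)
    {p : ℕ} (F : Fin p → Fin p → Prop) (hF : IsAcyclicDigraph F)
    (hFc : (SimpleGraph.fromRel F).Connected) : HasRestrictedDualForOrientations C F := by
  obtain ⟨K, hK⟩ := exists_sparse_of_omegaBoundedExpansion hC (2 ^ p)
  obtain ⟨N, hN⟩ := exists_centered_coloring K (2 ^ p)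
  obtain ⟨ι, hι, B, hB, hret⟩ := exists_retract_family (2 ^ p) Unit
  set s : Set ι := {i | ¬ ∃ f : Fin p → (B i).V, ∀ u v, F u v → (B i).arc (f u) (f v)} with hs
  let X := Σ i : s, (B i).V
  let W := Σ c : Fin N, ({I : Finset (Fin N) // I.card ≤ p ∧ c ∈ I} → X)
  let D : W → W → Prop := fun x y => ∀ (I : Finset (Fin N)) (hx : I.card ≤ p ∧ x.1 ∈ I)
    (hy : I.card ≤ p ∧ y.1 ∈ I), SigmaArc (fun i : s => B i) (x.2 ⟨I, hx⟩) (y.2 ⟨I, hy⟩)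
  have hFD : ∀ f : Fin p → W, ¬ ∀ u v, F u v → D (f u) (f v) := by
    intro f hf
    set I : Finset (Fin N) := Finset.univ.image fun u => (f u).1 with hI
    have hIc : ∀ u, I.card ≤ p ∧ (f u).1 ∈ I := fun u =>
      ⟨by simpa using (Finset.card_image_le : I.card ≤ (Finset.univ : Finset (Fin p)).card),
        Finset.mem_image_of_mem _ (Finset.mem_univ u)⟩
    obtain ⟨i, g, hg⟩ := exists_hom_of_sigmaArc (B := fun i : s => B i) hFc
      (fun u => (f u).2 ⟨I, hIc u⟩) (fun u v huv => hf u v huv I (hIc u) (hIc v))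
    exact i.2 ⟨g, hg⟩
  have hAD : ∀ ⦃n : ℕ⦄ (A : Fin n → Fin n → Prop) (G : SimpleGraph (Fin n)),
      G ∈ C n → IsOrientationOf A G → ¬ DigraphHomEx F A →
      ∃ f : Fin n → W, ∀ u v, A u v → D (f u) (f v) := by
    intro n A G hG hA hFA
    have hadj : ∀ x y, A x y → G.Adj x y := fun x y h => (hA.2 x y).2 (Or.inl h)
    obtain ⟨c, hc⟩ := hN (hK G hG (omegaNum_lt_of_not_hom hA hF hFA))
    have htd : ∀ I : {I : Finset (Fin N) // I.card ≤ p}, TD G (2 ^ p) {v | c v ∈ I.1} := by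
      rintro ⟨I, hI⟩
      refine td_of_shortFrom _ _ fun v hv => ⟨v, Joined.refl hv, fun l hl hnd hlS => ?_⟩
      have hle : 2 ^ I.card ≤ 2 ^ p := Nat.pow_le_pow_right (by norm_num) hI
      exact (length_lt_of_centered hc I hle _ hl hnd hlS).le.trans hle
    choose g _ hg2 φ _ _ hφ using fun I => hret (fun _ => ()) A _ hadj (htd I)
    have hmem : ∀ I v, (g I v).1 ∈ s := fun I v ⟨f, hf⟩ =>
      hFA ⟨fun u => φ I v (f u), fun u w huw => hφ I v _ _ (hf u w huw)⟩
    refine ⟨fun v => ⟨c v, fun I => ⟨⟨(g ⟨I.1, I.2.1⟩ ⟨v, I.2.2⟩).1, hmem _ _⟩,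
      (g ⟨I.1, I.2.1⟩ ⟨v, I.2.2⟩).2⟩⟩, fun u v huv I hu hv => ?_⟩
    exact (hg2 ⟨I, hu.1⟩ ⟨u, hu.2⟩ ⟨v, hv.2⟩ huv).restrict s _ _
  have : Finite X := inferInstance
  have : Finite W := inferInstance
  set e := Finite.equivFin W with he
  have hFD' : ¬ DigraphHomEx F fun x y => D (e.symm x) (e.symm y) := by
    rintro ⟨f, hf⟩
    exact hFD _ hf
  refine ⟨Nat.card W, _, hFD', fun n A G hG hA => ⟨fun h => ?_, ?_⟩⟩
  · obtain ⟨f, hf⟩ := hAD A G hG hA h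
    exact ⟨fun v => e (f v), fun u v huv => by simpa using hf u v huv⟩
  · rintro ⟨f, hf⟩ ⟨g, hg⟩
    exact hFD' ⟨fun u => f (g u), fun u v huv => hf _ _ (hg u v huv)⟩

/-! ## Restricted duals of ordered patterns -/

/-- `D` is a restricted dual of `F` for the orientations of the graphs of `C`. -/
def IsRestrictedDual (C : GraphClass) {p m : ℕ} (F : Fin p → Fin p → Prop)
    (D : Fin m → Fin m → Prop) : Prop :=
  ¬ DigraphHomEx F D ∧
    ∀ ⦃n : ℕ⦄ (A : Fin n → Fin n → Prop) (G : SimpleGraph (Fin n)),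
      G ∈ C n → IsOrientationOf A G → (¬ DigraphHomEx F A ↔ DigraphHomEx A D)

/-- Every acyclic connected digraph has a restricted dual for the orientations of `C`. -/
def HasDuals (C : GraphClass) : Prop :=
  ∀ (p : ℕ) (F : Fin p → Fin p → Prop), IsAcyclicDigraph F → (SimpleGraph.fromRel F).Connected →
    ∃ (m : ℕ) (D : Fin m → Fin m → Prop), IsRestrictedDual C F D

theorem HasDuals.exists_dual {C : GraphClass} (h : HasDuals C) {p : ℕ}
    (F : Fin (p + 1) → Fin (p + 1) → Prop) (hlt : ∀ i j, F i j → i < j)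
    (hsucc : ∀ i j : Fin (p + 1), (i : ℕ) + 1 = j → F i j) :
    ∃ (m : ℕ) (D : Fin m → Fin m → Prop), IsRestrictedDual C F D := by
  refine h _ F (fun v hv => ?_) ?_
  · have key : ∀ u v, Relation.TransGen F u v → u < v := by
      intro u v huv
      induction huv with
      | single h => exact hlt _ _ h
      | tail _ h ih => exact ih.trans (hlt _ _ h)
    exact lt_irrefl _ (key v v hv)
  · have key : ∀ k (hk : k < p + 1), (SimpleGraph.fromRel F).Reachable 0 ⟨k, hk⟩ := by
      intro k
      induction k with
      | zero => exact fun hk => SimpleGraph.Reachable.refl _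
      | succ k ih =>
        intro hk
        refine (ih (by omega)).trans (SimpleGraph.Adj.reachable ?_)
        refine (SimpleGraph.fromRel_adj _ _ _).2 ⟨?_, Or.inl (hsucc _ _ rfl)⟩
        intro h
        have := congrArg Fin.val h
        simp at this
    exact (SimpleGraph.connected_iff _).2
      ⟨fun u v => (key u u.2).symm.trans (key v v.2), ⟨0⟩⟩

/-- Orientations of graphs that embed in a graph of a hereditary class map to the dual. -/
theorem IsRestrictedDual.exists_hom {C : GraphClass} (hC : Hereditary C) {p m : ℕ}
    {F : Fin p → Fin p → Prop} {D : Fin m → Fin m → Prop} (hD : IsRestrictedDual C F D)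
    {n : ℕ} {G : SimpleGraph (Fin n)} (hG : G ∈ C n) {V : Type} [Fintype V] {G' : SimpleGraph V}
    (e : G' ↪g G) (A : V → V → Prop) (hA : ∀ u v, A u v → ¬ A v u)
    (hAG : ∀ u v, G'.Adj u v ↔ A u v ∨ A v u)
    (hF : ∀ f : Fin p → V, ¬ ∀ u v, F u v → A (f u) (f v)) :
    ∃ φ : V → Fin m, ∀ u v, A u v → D (φ u) (φ v) := by
  let ε := Fintype.equivFin V
  have hmem : G'.comap ε.symm ∈ C (Fintype.card V) :=
    hC G _ hG ⟨(SimpleGraph.Embedding.comap ε.symm.toEmbedding G').trans e⟩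
  obtain ⟨φ, hφ⟩ := (hD.2 (fun x y => A (ε.symm x) (ε.symm y)) _ hmem
    ⟨fun u v h => hA _ _ h.1 h.2, fun u v => by
      rw [SimpleGraph.comap_adj]
      exact hAG _ _⟩).1 (by
    rintro ⟨f, hf⟩
    exact hF _ hf)
  exact ⟨fun v => φ (ε v), fun u v h => hφ _ _ (by simpa using h)⟩

/-! ## Duals of transitive tournaments bound the chromatic number -/

theorem le_omegaNum {n m : ℕ} {G : SimpleGraph (Fin n)}
    (h : IsSubgraphOf (⊤ : SimpleGraph (Fin m)) G) : m ≤ omegaNum G := by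
  refine le_csSup ⟨n, ?_⟩ h
  rintro k ⟨f, hf⟩
  simpa using Fintype.card_le_of_injective f hf

theorem HasDuals.exists_coloring {C : GraphClass} (h : HasDuals C) (k : ℕ) :
    ∃ N, ∀ ⦃n : ℕ⦄ (G : SimpleGraph (Fin n)), G ∈ C n → omegaNum G ≤ k →
      ∃ φ : Fin n → Fin N, ∀ u v, G.Adj u v → φ u ≠ φ v := by
  obtain ⟨N, D, hD1, hD2⟩ := h.exists_dual (p := k) (fun i j => i < j) (fun _ _ => id)
    (fun i j h => Fin.lt_def.2 (by omega))
  have hloop : ∀ x, ¬ D x x := fun x hx => hD1 ⟨fun _ => x, fun _ _ _ => hx⟩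
  refine ⟨N, fun n G hG hk => ?_⟩
  have hor : ∀ u v, G.Adj u v ↔ (G.Adj u v ∧ u < v) ∨ (G.Adj v u ∧ v < u) := by
    intro u v
    refine ⟨fun h => ?_, ?_⟩
    · rcases lt_or_gt_of_ne h.ne with h' | h'
      · exact Or.inl ⟨h, h'⟩
      · exact Or.inr ⟨h.symm, h'⟩
    · rintro (h | h)
      · exact h.1
      · exact h.1.symm
  obtain ⟨φ, hφ⟩ := (hD2 (fun u v => G.Adj u v ∧ u < v) G hG
    ⟨fun u v h => lt_asymm h.1.2 h.2.2, hor⟩).1 (by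
      rintro ⟨f, hf⟩
      have hf' : ∀ i j, i ≠ j → G.Adj (f i) (f j) := by
        intro i j hij
        rcases lt_or_gt_of_ne hij with h | h
        · exact (hf i j h).1
        · exact (hf j i h).1.symm
      have := le_omegaNum (m := k + 1) (G := G) ⟨⟨f, fun {i j} h => hf' i j h⟩, fun i j hij => by
        by_contra hne
        exact (hf' i j hne).ne hij⟩
      omega)
  refine ⟨φ, fun u v huv heq => ?_⟩
  rcases lt_or_gt_of_ne huv.ne with h | h
  · exact hloop _ (heq ▸ hφ u v ⟨huv, h⟩)
  · exact hloop _ (heq ▸ hφ v u ⟨huv.symm, h⟩)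

/-! ## Bipartite graphs of the class are degenerate -/

/-- The digraph on five vertices whose arcs join vertices of distinct parity increasingly. -/
def oddArcs (i j : Fin 5) : Prop := i < j ∧ (i + j : ℕ) % 2 = 1

theorem exists_small_degree {C : GraphClass} (hC : Hereditary C) {N : ℕ}
    {D : Fin N → Fin N → Prop} (hD : IsRestrictedDual C oddArcs D) {n : ℕ}
    {G : SimpleGraph (Fin n)} (hG : G ∈ C n) (X Y : Finset (Fin n)) (hXY : Disjoint X Y)
    (hX : ∀ x ∈ X, ∀ y ∈ X, ¬ G.Adj x y) (hY : ∀ x ∈ Y, ∀ y ∈ Y, ¬ G.Adj x y)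
    (hcard : X.card ≤ Y.card) (hne : Y.Nonempty) :
    ∃ y ∈ Y, (X.filter (G.Adj y)).card ≤ N ^ 2 := by
  by_contra! hcon
  have hdigon : ∀ x y, D x y → ¬ D y x := by
    intro x y hxy hyx
    refine hD.1 ⟨fun i => if (i : ℕ) % 2 = 0 then x else y, fun i j hij => ?_⟩
    obtain ⟨h1, h2⟩ := hij
    rcases Nat.mod_two_eq_zero_or_one i with hi | hi
    · have hj : ¬ (j : ℕ) % 2 = 0 := by omega
      simp only [hi, hj, if_true, if_false]
      exact hxy
    · have hj : (j : ℕ) % 2 = 0 := by omega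
      have hi' : ¬ (i : ℕ) % 2 = 0 := by omega
      simp only [hi', hj, if_true, if_false]
      exact hyx
  have hemb : ∀ y : Y, ∃ g : Fin (N ^ 2 + 1) → Fin n, Function.Injective g ∧
      ∀ i, g i ∈ X ∧ G.Adj y (g i) := by
    intro y
    obtain ⟨T, hT, hTc⟩ := Finset.exists_subset_card_eq (hcon y y.2)
    refine ⟨fun i => (T.equivFin.symm (Fin.cast hTc.symm i)).1, fun i j hij => ?_, fun i => ?_⟩
    · simpa using T.equivFin.symm.injective (Subtype.ext hij)
    · exact Finset.mem_filter.1 (hT (T.equivFin.symm (Fin.cast hTc.symm i)).2)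
  choose g hginj hg using hemb
  have hhom : ∀ f : Y → Fin (N ^ 2 + 1), ∃ φ : (X ∪ Y : Finset (Fin n)) → Fin N,
      ∀ (x : Fin n) (hx : x ∈ X) (y : Fin n) (hy : y ∈ Y), G.Adj x y →
        (x = g ⟨y, hy⟩ (f ⟨y, hy⟩) ↔ D (φ ⟨y, Finset.mem_union_right _ hy⟩)
          (φ ⟨x, Finset.mem_union_left _ hx⟩)) := by
    intro f
    let A : Fin n → Fin n → Prop := fun u v => G.Adj u v ∧
      ((∃ hu : u ∈ Y, v = g ⟨u, hu⟩ (f ⟨u, hu⟩)) ∨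
        u ∈ X ∧ ∃ hv : v ∈ Y, u ≠ g ⟨v, hv⟩ (f ⟨v, hv⟩))
    have hnot : ∀ x ∈ X, x ∉ Y := fun x hx => Finset.disjoint_left.1 hXY hx
    have hout : ∀ y ∈ Y, ∀ u v, A y u → A y v → u = v := by
      rintro y hy u v ⟨-, ⟨_, rfl⟩ | ⟨h, _⟩⟩ ⟨-, ⟨_, rfl⟩ | ⟨h', _⟩⟩
      · rfl
      · exact absurd hy (hnot _ h')
      · exact absurd hy (hnot _ h)
      · exact absurd hy (hnot _ h)
    have hasymm : ∀ u v, A u v → ¬ A v u := by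
      rintro u v ⟨-, ⟨hu, h1⟩ | ⟨hu, hv, h1⟩⟩ ⟨-, ⟨hv', h2⟩ | ⟨hv', hu', h2⟩⟩
      · exact hnot _ (h1 ▸ (hg ⟨u, hu⟩ _).1) hv'
      · exact h2 h1
      · exact h1 h2
      · exact hnot _ hu hu'
    have hside : ∀ u v, A u v → u ∈ Y ∨ v ∈ Y := by
      rintro u v ⟨-, ⟨hu, h1⟩ | ⟨hu, hv, h1⟩⟩
      · exact Or.inl hu
      · exact Or.inr hv
    have hF : ∀ h : Fin 5 → Fin n, ¬ ∀ i j, oddArcs i j → A (h i) (h j) := by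
      intro h hh
      have h01 := hh 0 1 ⟨by decide, by decide⟩
      have h03 := hh 0 3 ⟨by decide, by decide⟩
      have h12 := hh 1 2 ⟨by decide, by decide⟩
      have h23 := hh 2 3 ⟨by decide, by decide⟩
      have h14 := hh 1 4 ⟨by decide, by decide⟩
      have h34 := hh 3 4 ⟨by decide, by decide⟩
      rcases hside _ _ h01 with hy | hy
      · have := hout _ hy _ _ h01 h03
        rw [← this] at h23
        exact hasymm _ _ h12 h23
      · have := hout _ hy _ _ h12 h14
        rw [← this] at h34
        exact hasymm _ _ h23 h34
    obtain ⟨φ, hφ⟩ := hD.exists_hom hC hG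
      (SimpleGraph.Embedding.comap (Function.Embedding.subtype fun v => v ∈ X ∪ Y) G)
      (fun u v => A u v) (fun u v => hasymm _ _) (by
        rintro ⟨u, hu⟩ ⟨v, hv⟩
        rw [SimpleGraph.comap_adj]
        refine ⟨fun h => ?_, ?_⟩
        · have h' : G.Adj u v := h
          have key : ∀ x ∈ X, ∀ y ∈ Y, G.Adj x y → A x y ∨ A y x := by
            intro x hx y hy hxy
            by_cases he : x = g ⟨y, hy⟩ (f ⟨y, hy⟩)
            · exact Or.inr ⟨hxy.symm, Or.inl ⟨hy, he⟩⟩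
            · exact Or.inl ⟨hxy, Or.inr ⟨hx, hy, he⟩⟩
          rcases Finset.mem_union.1 hu with hu | hu <;> rcases Finset.mem_union.1 hv with hv | hv
          · exact absurd h' (hX _ hu _ hv)
          · exact key _ hu _ hv h'
          · exact (key _ hv _ hu h'.symm).symm
          · exact absurd h' (hY _ hu _ hv)
        · rintro (h | h)
          · exact h.1
          · exact h.1.symm) fun h => hF fun i => h i
    refine ⟨φ, fun x hx y hy hxy => ⟨fun h => ?_, fun h => ?_⟩⟩
    · exact hφ ⟨y, _⟩ ⟨x, _⟩ ⟨hxy.symm, Or.inl ⟨hy, h⟩⟩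
    · by_contra hne
      exact hdigon _ _ h (hφ ⟨x, _⟩ ⟨y, _⟩ ⟨hxy, Or.inr ⟨hx, hy, hne⟩⟩)
  choose φ hφ using hhom
  have hinj : Function.Injective φ := by
    intro f f' h
    funext ⟨y, hy⟩
    have h1 := (hφ f _ (hg ⟨y, hy⟩ (f ⟨y, hy⟩)).1 y hy (hg ⟨y, hy⟩ _).2.symm).1 rfl
    rw [h] at h1
    exact hginj _ ((hφ f' _ (hg ⟨y, hy⟩ (f ⟨y, hy⟩)).1 y hy (hg ⟨y, hy⟩ _).2.symm).2 h1)
  have hc := Fintype.card_le_of_injective φ hinj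
  simp only [Fintype.card_fun, Fintype.card_fin, Fintype.card_coe] at hc
  have hN : 0 < N := by
    obtain ⟨y, hy⟩ := hne
    exact (Nat.zero_le _).trans_lt (φ (fun _ => 0) ⟨y, Finset.mem_union_right _ hy⟩).2
  have h1 : N ^ (X ∪ Y).card ≤ (N ^ 2) ^ Y.card := by
    rw [← pow_mul]
    refine Nat.pow_le_pow_right hN ((Finset.card_union_le _ _).trans ?_)
    omega
  have h2 : (N ^ 2) ^ Y.card < (N ^ 2 + 1) ^ Y.card :=
    Nat.pow_lt_pow_left (Nat.lt_succ_self _) (Finset.card_pos.2 hne).ne'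
  omega

/-- The subgraph of the edges between two vertex sets. -/
def between {V : Type} (G : SimpleGraph V) (P Q : V → Prop) : SimpleGraph V :=
  SimpleGraph.fromRel fun x y => G.Adj x y ∧ P x ∧ Q y

theorem degenerate_between {C : GraphClass} (hC : Hereditary C) {N : ℕ}
    {D : Fin N → Fin N → Prop} (hD : IsRestrictedDual C oddArcs D) {n : ℕ}
    {G : SimpleGraph (Fin n)} (hG : G ∈ C n) (P Q : Fin n → Prop) (hPQ : ∀ x, P x → ¬ Q x)
    (hP : ∀ x y, P x → P y → ¬ G.Adj x y) (hQ : ∀ x y, Q x → Q y → ¬ G.Adj x y) :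
    Degenerate (between G P Q) (N ^ 2) := by
  intro U hU
  by_contra! hcon
  have hsub : ∀ v ∈ U, (P v ∨ Q v) ∧
      (P v → N ^ 2 < ((U.filter Q).filter (G.Adj v)).card) ∧
      (Q v → N ^ 2 < ((U.filter P).filter (G.Adj v)).card) := by
    intro v hv
    refine ⟨?_, fun hp => (hcon v hv).trans_le (Finset.card_le_card fun u hu => ?_),
      fun hq => (hcon v hv).trans_le (Finset.card_le_card fun u hu => ?_)⟩
    · obtain ⟨u, hu⟩ := Finset.card_pos.1 ((Nat.zero_le _).trans_lt (hcon v hv))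
      rcases ((SimpleGraph.fromRel_adj _ _ _).1 (Finset.mem_filter.1 hu).2).2 with h | h
      · exact Or.inl h.2.1
      · exact Or.inr h.2.2
    · obtain ⟨hu, h⟩ := Finset.mem_filter.1 hu
      rcases ((SimpleGraph.fromRel_adj _ _ _).1 h).2 with h | h
      · exact Finset.mem_filter.2 ⟨Finset.mem_filter.2 ⟨hu, h.2.2⟩, h.1⟩
      · exact absurd h.2.2 (hPQ _ hp)
    · obtain ⟨hu, h⟩ := Finset.mem_filter.1 hu
      rcases ((SimpleGraph.fromRel_adj _ _ _).1 h).2 with h | h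
      · exact absurd hq (hPQ _ h.2.1)
      · exact Finset.mem_filter.2 ⟨Finset.mem_filter.2 ⟨hu, h.2.1⟩, h.1.symm⟩
  have hmem : ∀ (P : Fin n → Prop) x, x ∈ U.filter P → x ∈ U ∧ P x := fun P x hx =>
    Finset.mem_filter.1 hx
  have hdisj : Disjoint (U.filter P) (U.filter Q) := Finset.disjoint_left.2 fun x hx hx' =>
    hPQ x (hmem _ _ hx).2 (hmem _ _ hx').2
  have hunion : U.card ≤ (U.filter P).card + (U.filter Q).card := by
    refine (Finset.card_le_card fun x hx => ?_).trans (Finset.card_union_le _ _)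
    exact Finset.mem_union.2 ((hsub x hx).1.imp (fun h => Finset.mem_filter.2 ⟨hx, h⟩)
      fun h => Finset.mem_filter.2 ⟨hx, h⟩)
  have hpos := Finset.card_pos.2 hU
  rcases le_total (U.filter P).card (U.filter Q).card with hle | hle
  · obtain ⟨y, hy, hyc⟩ := exists_small_degree hC hD hG _ _ hdisj
      (fun x hx y hy => hP x y (hmem _ _ hx).2 (hmem _ _ hy).2)
      (fun x hx y hy => hQ x y (hmem _ _ hx).2 (hmem _ _ hy).2) hle
      (Finset.card_pos.1 (by omega))
    have := (hsub y (hmem _ _ hy).1).2.2 (hmem _ _ hy).2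
    omega
  · obtain ⟨y, hy, hyc⟩ := exists_small_degree hC hD hG _ _ hdisj.symm
      (fun x hx y hy => hQ x y (hmem _ _ hx).2 (hmem _ _ hy).2)
      (fun x hx y hy => hP x y (hmem _ _ hx).2 (hmem _ _ hy).2) hle
      (Finset.card_pos.1 (by omega))
    have := (hsub y (hmem _ _ hy).1).2.1 (hmem _ _ hy).2
    omega

/-- The graphs of bounded clique number in the class are uniformly sparse. -/
theorem HasDuals.exists_out {C : GraphClass} (hC : Hereditary C) (h : HasDuals C) (k : ℕ) :
    ∃ d, ∀ ⦃n : ℕ⦄ (G : SimpleGraph (Fin n)), G ∈ C n → omegaNum G ≤ k →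
      ∃ out : Fin n → Finset (Fin n), (∀ v, (out v).card ≤ d) ∧
        ∀ x y, G.Adj x y → y ∈ out x ∨ x ∈ out y := by
  obtain ⟨N, hN⟩ := h.exists_coloring k
  obtain ⟨M, D, hD⟩ := h.exists_dual oddArcs (fun i j h => h.1)
    (fun i j h => ⟨Fin.lt_def.2 (by omega), by omega⟩)
  refine ⟨N * N * M ^ 2, fun n G hG hk => ?_⟩
  obtain ⟨c, hc⟩ := hN G hG hk
  have hout : ∀ q : Fin N × Fin N, ∃ out : Fin n → Finset (Fin n), (∀ v, (out v).card ≤ M ^ 2) ∧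
      ∀ x y, G.Adj x y → c x = q.1 → c y = q.2 → y ∈ out x ∨ x ∈ out y := by
    rintro ⟨i, j⟩
    rcases eq_or_ne i j with rfl | hij
    · exact ⟨fun _ => ∅, by simp, fun x y h h1 h2 => absurd (h1.trans h2.symm) (hc x y h)⟩
    obtain ⟨out, h1, -, h3⟩ := (degenerate_between hC hD hG (fun v => c v = i) (fun v => c v = j)
      (fun x hx hx' => hij (hx.symm.trans hx')) (fun x y hx hy h => hc x y h (hx.trans hy.symm))
      (fun x y hx hy h => hc x y h (hx.trans hy.symm))).exists_out
    exact ⟨out, h1, fun x y h hx hy => h3 x y ((SimpleGraph.fromRel_adj _ _ _).2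
      ⟨h.ne, Or.inl ⟨h, hx, hy⟩⟩)⟩
  choose out h1 h2 using hout
  refine ⟨fun v => Finset.univ.biUnion fun q => out q v, fun v => ?_, fun x y hxy => ?_⟩
  · refine Finset.card_biUnion_le.trans ((Finset.sum_le_sum fun q _ => h1 q v).trans ?_)
    simp
  · rcases h2 (c x, c y) x y hxy rfl rfl with h | h
    · exact Or.inl (Finset.mem_biUnion.2 ⟨_, Finset.mem_univ _, h⟩)
    · exact Or.inr (Finset.mem_biUnion.2 ⟨_, Finset.mem_univ _, h⟩)

/-! ## Orientations of exact subdivisions -/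

section subdivArc

variable {n : ℕ} {H : SimpleGraph (Fin n)} {s : ℕ} (T : Edges H → Bool)

/-- The orientation of the exact `s`-subdivision of `H` in which the path replacing an edge `e` is
directed from the smaller end to the larger one if `T e` holds, and otherwise has its first
internal vertex as a sink, towards which all its arcs are directed. -/
def subdivArc : (Fin n ⊕ Σ _ : Edges H, Fin s) → (Fin n ⊕ Σ _ : Edges H, Fin s) → Prop
  | Sum.inl _, Sum.inl _ => False
  | Sum.inl u, Sum.inr ⟨e, i⟩ =>
      (u = e.1.1 ∧ (i : ℕ) = 0) ∨ (T e = false ∧ u = e.1.2 ∧ (i : ℕ) + 1 = s)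
  | Sum.inr ⟨e, i⟩, Sum.inl v => T e = true ∧ v = e.1.2 ∧ (i : ℕ) + 1 = s
  | Sum.inr ⟨e, i⟩, Sum.inr ⟨e', j⟩ =>
      e = e' ∧ ((T e = true ∧ (i : ℕ) + 1 = j) ∨ (T e = false ∧ (j : ℕ) + 1 = i))

/-- The vertices of the path replacing `e`, the larger end of `e` included. -/
def pathVertex (e : Edges H) (k : ℕ) : Fin n ⊕ Σ _ : Edges H, Fin s :=
  if h : k < s then Sum.inr ⟨e, ⟨k, h⟩⟩ else Sum.inl e.1.2

theorem pathVertex_of_lt {e : Edges H} {k : ℕ} (h : k < s) :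
    pathVertex e k = (Sum.inr ⟨e, ⟨k, h⟩⟩ : Fin n ⊕ Σ _ : Edges H, Fin s) :=
  dif_pos h

theorem inr_eq {e : Edges H} {i j : Fin s} (h : (i : ℕ) = j) :
    (Sum.inr ⟨e, i⟩ : Fin n ⊕ Σ _ : Edges H, Fin s) = Sum.inr ⟨e, j⟩ := by
  rw [Fin.ext h]

theorem pathVertex_self {e : Edges H} :
    pathVertex e s = (Sum.inl e.1.2 : Fin n ⊕ Σ _ : Edges H, Fin s) :=
  dif_neg (lt_irrefl s)

theorem subdiv_adj_iff (hs : 1 ≤ s) (x y : Fin n ⊕ Σ _ : Edges H, Fin s) :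
    (Subdiv H fun _ => s).Adj x y ↔ subdivArc T x y ∨ subdivArc T y x := by
  rw [Subdiv, SimpleGraph.fromRel_adj]
  rcases x with u | ⟨e, i⟩ <;> rcases y with v | ⟨e', j⟩
  · simp only [subdivRel, subdivArc, or_self, iff_false]
    rintro ⟨-, ⟨-, h⟩ | ⟨-, h⟩⟩ <;> omega
  · cases h : T e' <;> simp [subdivRel, subdivArc, h]
  · cases h : T e <;> simp [subdivRel, subdivArc, h, or_comm]
  · constructor
    · rintro ⟨-, ⟨rfl, h⟩ | ⟨rfl, h⟩⟩
      · cases hT : T e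
        · exact Or.inr ⟨rfl, Or.inr ⟨hT, h⟩⟩
        · exact Or.inl ⟨rfl, Or.inl ⟨hT, h⟩⟩
      · cases hT : T e'
        · exact Or.inl ⟨rfl, Or.inr ⟨hT, h⟩⟩
        · exact Or.inr ⟨rfl, Or.inl ⟨hT, h⟩⟩
    · intro h
      have hne : ∀ (e : Edges H) (i j : Fin s), (i : ℕ) + 1 = j ∨ (j : ℕ) + 1 = i →
          (Sum.inr ⟨e, i⟩ : Fin n ⊕ Σ _ : Edges H, Fin s) ≠ Sum.inr ⟨e, j⟩ := by
        intro e i j h heq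
        simp only [Sum.inr.injEq, Sigma.mk.injEq, heq_eq_eq, true_and] at heq
        subst heq
        omega
      rcases h with ⟨rfl, ⟨-, h⟩ | ⟨-, h⟩⟩ | ⟨rfl, ⟨-, h⟩ | ⟨-, h⟩⟩
      · exact ⟨hne _ _ _ (Or.inl h), Or.inl ⟨rfl, h⟩⟩
      · exact ⟨hne _ _ _ (Or.inr h), Or.inr ⟨rfl, h⟩⟩
      · exact ⟨hne _ _ _ (Or.inr h), Or.inr ⟨rfl, h⟩⟩
      · exact ⟨hne _ _ _ (Or.inl h), Or.inl ⟨rfl, h⟩⟩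

/-- A potential that increases along the arcs of `subdivArc`. -/
def subdivRank : (Fin n ⊕ Σ _ : Edges H, Fin s) → ℕ
  | Sum.inl u => u * (s + 2)
  | Sum.inr ⟨e, i⟩ => if T e = true then e.1.1 * (s + 2) + i + 1 else (n + 1) * (s + 2) - i

theorem subdivRank_lt {x y : Fin n ⊕ Σ _ : Edges H, Fin s} (h : subdivArc T x y) :
    subdivRank T x < subdivRank T y := by
  have hmul : ∀ a b : ℕ, a < b → a * (s + 2) + (s + 2) ≤ b * (s + 2) := by
    intro a b hab
    rw [← Nat.succ_mul]
    exact Nat.mul_le_mul_right _ hab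
  rcases x with u | ⟨e, i⟩ <;> rcases y with v | ⟨e', j⟩
  · exact h.elim
  · have h1 := hmul u (n + 1) (by omega)
    have hj := j.2
    rcases h with ⟨rfl, h⟩ | ⟨hT, rfl, h⟩
    · cases hT : T e'
      · simp [subdivRank, hT]
        omega
      · simp [subdivRank, hT]
    · simp only [subdivRank, hT]
      simp
      omega
  · obtain ⟨hT, rfl, h⟩ := h
    have h1 := hmul _ _ (Fin.lt_def.1 e.2.1)
    simp only [subdivRank, hT, if_true]
    omega
  · obtain ⟨rfl, ⟨hT, h⟩ | ⟨hT, h⟩⟩ := h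
    · simp only [subdivRank, hT, if_true]
      omega
    · have h1 := hmul n (n + 1) (by omega)
      have hi := i.2
      simp only [subdivRank, hT]
      simp
      omega

theorem subdivRank_lt_pathVertex {e : Edges H} (hT : T e = false) (k : ℕ) :
    subdivRank T (Sum.inl e.1.1 : Fin n ⊕ Σ _ : Edges H, Fin s) <
      subdivRank T (pathVertex e k : Fin n ⊕ Σ _ : Edges H, Fin s) := by
  have hlt := Fin.lt_def.1 e.2.1
  by_cases hk : k < s
  · have h1 : ((e.1.1 : ℕ) + 1) * (s + 2) ≤ (n + 1) * (s + 2) :=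
      Nat.mul_le_mul_right _ (by omega)
    rw [Nat.succ_mul] at h1
    rw [pathVertex_of_lt hk]
    simp only [subdivRank, hT]
    simp
    omega
  · rw [pathVertex, dif_neg hk]
    exact Nat.mul_lt_mul_of_pos_right hlt (by omega)

theorem subdivArc_inr {e : Edges H} {i : Fin s} {y : Fin n ⊕ Σ _ : Edges H, Fin s}
    (h : subdivArc T (Sum.inr ⟨e, i⟩) y) :
    if T e = true then y = pathVertex e (i + 1) else ∃ j, y = Sum.inr ⟨e, j⟩ := by
  rcases y with v | ⟨e', j⟩
  · obtain ⟨hT, rfl, h⟩ := h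
    rw [if_pos hT, h, pathVertex_self]
  · obtain ⟨rfl, ⟨hT, h⟩ | ⟨hT, h⟩⟩ := h
    · rw [if_pos hT, pathVertex_of_lt (by omega)]
      exact inr_eq h.symm
    · simp [hT]

theorem subdivArc_of_true {e : Edges H} {j : Fin s} {x : Fin n ⊕ Σ _ : Edges H, Fin s}
    (hT : T e = true) (h : subdivArc T x (Sum.inr ⟨e, j⟩)) :
    x = if (j : ℕ) = 0 then Sum.inl e.1.1 else pathVertex e (j - 1) := by
  rcases x with u | ⟨e', i⟩
  · rcases h with ⟨rfl, h⟩ | ⟨hT', -, h⟩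
    · rw [if_pos h]
    · simp [hT] at hT'
  · obtain ⟨rfl, ⟨-, h⟩ | ⟨hT', h⟩⟩ := h
    · rw [if_neg (by omega), pathVertex_of_lt (by omega)]
      exact inr_eq (show (i : ℕ) = j - 1 by omega)
    · simp [hT] at hT'

theorem subdivArc_of_false {e : Edges H} {j : Fin s} {x : Fin n ⊕ Σ _ : Edges H, Fin s}
    (hT : T e = false) (h : subdivArc T x (Sum.inr ⟨e, j⟩)) :
    (x = Sum.inl e.1.1 ∧ (j : ℕ) = 0) ∨ x = pathVertex e (j + 1) := by
  rcases x with u | ⟨e', i⟩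
  · rcases h with ⟨rfl, h⟩ | ⟨-, rfl, h⟩
    · exact Or.inl ⟨rfl, h⟩
    · rw [h, pathVertex_self]
      exact Or.inr rfl
  · obtain ⟨rfl, ⟨hT', h⟩ | ⟨-, h⟩⟩ := h
    · simp [hT] at hT'
    · right
      rw [pathVertex_of_lt (by omega)]
      exact inr_eq h.symm

theorem pathVertex_of_walk_true {w : ℕ → Fin n ⊕ Σ _ : Edges H, Fin s} {m : ℕ}
    (hw : ∀ i < m, subdivArc T (w i) (w (i + 1))) {e : Edges H} (hT : T e = true)
    {a : ℕ} (ha : w a = pathVertex e 0) (k : ℕ) (hk : k ≤ s) (hkm : a + k ≤ m) :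
    w (a + k) = pathVertex e k := by
  induction k with
  | zero => exact ha
  | succ k ih =>
    have h1 := ih (by omega) (by omega)
    rw [pathVertex_of_lt (by omega)] at h1
    have h2 := hw (a + k) (by omega)
    rw [h1] at h2
    have h3 := subdivArc_inr T h2
    rw [if_pos hT] at h3
    exact h3

theorem inr_of_walk_false {w : ℕ → Fin n ⊕ Σ _ : Edges H, Fin s} {m : ℕ}
    (hw : ∀ i < m, subdivArc T (w i) (w (i + 1))) {e : Edges H} (hT : T e = false)
    {a : ℕ} {i : Fin s} (ha : w a = Sum.inr ⟨e, i⟩) (k : ℕ) (hkm : a + k ≤ m) :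
    ∃ j, w (a + k) = Sum.inr ⟨e, j⟩ := by
  induction k with
  | zero => exact ⟨i, ha⟩
  | succ k ih =>
    obtain ⟨j, h1⟩ := ih (by omega)
    have h2 := hw (a + k) (by omega)
    rw [h1] at h2
    have h3 := subdivArc_inr T h2
    rw [if_neg (by simp [hT])] at h3
    exact h3

/-- No arc of `subdivArc` joins the ends of a walk of length `2 * s + 1`. -/
theorem not_subdivArc_of_walk (hs : 1 ≤ s) {w : ℕ → Fin n ⊕ Σ _ : Edges H, Fin s}
    (hw : ∀ i < 2 * s + 1, subdivArc T (w i) (w (i + 1))) :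
    ¬ subdivArc T (w 0) (w (2 * s + 1)) := by
  intro h
  have hmono : ∀ i j, i < j → j ≤ 2 * s + 1 → subdivRank T (w i) < subdivRank T (w j) := by
    intro i j hij hj
    induction j, hij using Nat.le_induction with
    | base => exact subdivRank_lt T (hw i (by omega))
    | succ j _ ih => exact (ih (by omega)).trans (subdivRank_lt T (hw j (by omega)))
  have hne : ∀ i j, i < j → j ≤ 2 * s + 1 → w i ≠ w j := fun i j hij hj heq =>
    absurd (hmono i j hij hj) (by rw [heq]; exact lt_irrefl _)
  have hlast := hw (2 * s) (by omega)
  rcases hy : w (2 * s + 1) with v | ⟨e, j⟩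
  · rw [hy] at h
    rcases hx : w 0 with u | ⟨e, i⟩
    · rw [hx] at h
      exact h
    · rw [hx] at h
      obtain ⟨hT, rfl, hi⟩ := h
      have h1 := hw 0 (by omega)
      rw [hx] at h1
      have h2 := subdivArc_inr T h1
      rw [if_pos hT, hi, pathVertex_self, ← hy] at h2
      exact hne 1 (2 * s + 1) (by omega) le_rfl h2
  · rw [hy] at h hlast
    cases hT : T e with
    | true =>
      exact hne 0 (2 * s) (by omega) (by omega)
        ((subdivArc_of_true T hT h).trans (subdivArc_of_true T hT hlast).symm)
    | false =>
      rcases subdivArc_of_false T hT h with ⟨hx, hj⟩ | hx <;>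
        rcases subdivArc_of_false T hT hlast with ⟨hz, hj'⟩ | hz
      · exact hne 0 (2 * s) (by omega) (by omega) (hx.trans hz.symm)
      · have hback : ∀ k, 1 ≤ k → k ≤ s → w (2 * s + 1 - k) = pathVertex e k := by
          intro k hk
          induction k, hk using Nat.le_induction with
          | base => exact fun _ => by rw [Nat.add_sub_cancel, hz, hj]
          | succ k hk ih =>
            intro hks
            have h1 := ih (by omega)
            rw [pathVertex_of_lt (by omega)] at h1
            have h2 := hw (2 * s + 1 - (k + 1)) (by omega)
            rw [show 2 * s + 1 - (k + 1) + 1 = 2 * s + 1 - k by omega, h1] at h2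
            rcases subdivArc_of_false T hT h2 with ⟨-, h3⟩ | h3
            · simp at h3
              omega
            · exact h3
        have hmid := hback s hs le_rfl
        rw [show 2 * s + 1 - s = 1 + s by omega, pathVertex_self] at hmid
        have h1 := hw 0 (by omega)
        rw [hx, zero_add] at h1
        rcases hw1 : w 1 with v | ⟨e', i⟩
        · rw [hw1] at h1
          exact h1
        · rw [hw1] at h1
          cases hT' : T e' with
          | false =>
            obtain ⟨i', hi'⟩ := inr_of_walk_false T hw hT' hw1 s (by omega)
            rw [hmid] at hi'
            exact absurd hi' (by simp)
          | true =>
            rcases h1 with ⟨h1, hi⟩ | ⟨h1, -⟩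
            · have hi0 : i = ⟨0, hs⟩ := Fin.ext hi
              rw [hi0, ← pathVertex_of_lt] at hw1
              have h2 := pathVertex_of_walk_true T hw hT' hw1 s le_rfl (by omega)
              rw [hmid, pathVertex_self] at h2
              have : e = e' := Subtype.ext (Prod.ext h1 (Sum.inl.inj h2))
              rw [this, hT'] at hT
              simp at hT
            · simp [hT'] at h1
      · have h1 := hmono 0 (2 * s) (by omega) (by omega)
        rw [hz, hx] at h1
        exact lt_asymm h1 (subdivRank_lt_pathVertex T hT _)
      · exact hne 0 (2 * s) (by omega) (by omega) (hx.trans hz.symm)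

end subdivArc

/-- A directed path on `2 * s + 2` vertices with an additional arc from its first vertex to its
last one. -/
def shortcutPath (s : ℕ) (i j : Fin (2 * s + 1 + 1)) : Prop :=
  (i : ℕ) + 1 = j ∨ ((i : ℕ) = 0 ∧ (j : ℕ) = 2 * s + 1)

theorem exists_shortcutPath_hom {n s m : ℕ} {H : SimpleGraph (Fin n)} {T T' : Edges H → Bool}
    {D : Fin m → Fin m → Prop} (hs : 1 ≤ s) {φ φ' : (Fin n ⊕ Σ _ : Edges H, Fin s) → Fin m}
    (hφ : ∀ x y, subdivArc T x y → D (φ x) (φ y))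
    (hφ' : ∀ x y, subdivArc T' x y → D (φ' x) (φ' y))
    (heq : ∀ v, φ (Sum.inl v) = φ' (Sum.inl v)) {e : Edges H} (hT : T e = true)
    (hT' : T' e = false) : DigraphHomEx (shortcutPath s) D := by
  have hstep : ∀ k < s, D (φ (pathVertex e k)) (φ (pathVertex e (k + 1))) := by
    intro k hk
    refine hφ _ _ ?_
    rw [pathVertex_of_lt hk]
    by_cases hk' : k + 1 < s
    · rw [pathVertex_of_lt hk']
      exact ⟨rfl, Or.inl ⟨hT, rfl⟩⟩
    · rw [show k + 1 = s by omega, pathVertex_self]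
      exact ⟨hT, rfl, show k + 1 = s by omega⟩
  have hstep' : ∀ k < s, D (φ' (pathVertex e (k + 1))) (φ' (pathVertex e k)) := by
    intro k hk
    refine hφ' _ _ ?_
    rw [pathVertex_of_lt hk]
    by_cases hk' : k + 1 < s
    · rw [pathVertex_of_lt hk']
      exact ⟨rfl, Or.inr ⟨hT', rfl⟩⟩
    · rw [show k + 1 = s by omega, pathVertex_self]
      exact Or.inr ⟨hT', rfl, show k + 1 = s by omega⟩
  have hfirst : D (φ (Sum.inl e.1.1)) (φ (pathVertex e 0)) := by
    refine hφ _ _ ?_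
    rw [pathVertex_of_lt hs]
    exact Or.inl ⟨rfl, rfl⟩
  have hfirst₂ : D (φ' (Sum.inl e.1.1)) (φ' (pathVertex e 0)) := by
    refine hφ' _ _ ?_
    rw [pathVertex_of_lt hs]
    exact Or.inl ⟨rfl, rfl⟩
  set w : ℕ → Fin m := fun i => if i = 0 then φ (Sum.inl e.1.1) else
    if i ≤ s + 1 then φ (pathVertex e (i - 1)) else φ' (pathVertex e (2 * s + 1 - i)) with hw
  have hw0 : w 0 = φ (Sum.inl e.1.1) := rfl
  have hw1 : ∀ k ≤ s, w (k + 1) = φ (pathVertex e k) := by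
    intro k hk
    simp [hw, hk]
  have hw2 : ∀ k ≤ s, w (2 * s + 1 - k) = φ' (pathVertex e k) := by
    intro k hk
    rcases hk.eq_or_lt with rfl | hk
    · rw [show 2 * k + 1 - k = k + 1 by omega, hw1 k le_rfl, pathVertex_self, heq]
    · simp only [hw]
      rw [if_neg (by omega), if_neg (by omega), show 2 * s + 1 - (2 * s + 1 - k) = k by omega]
  refine ⟨fun i => w i, ?_⟩
  rintro ⟨i, hi⟩ ⟨j, hj⟩ (h | ⟨h, h'⟩)
  · simp only at h
    subst h
    show D (w i) (w (i + 1))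
    rcases Nat.eq_zero_or_pos i with rfl | hi0
    · rw [hw0, hw1 0 (by omega)]
      exact hfirst
    · rcases Nat.lt_or_ge s i with his | his
      · have h1 := hstep' (2 * s - i) (by omega)
        rw [← hw2 _ (by omega), ← hw2 _ (by omega)] at h1
        rwa [show 2 * s + 1 - (2 * s - i + 1) = i by omega,
          show 2 * s + 1 - (2 * s - i) = i + 1 by omega] at h1
      · have h1 := hstep (i - 1) (by omega)
        rw [← hw1 _ (by omega), ← hw1 _ (by omega)] at h1
        rwa [show i - 1 + 1 = i by omega] at h1
  · simp only at h h'
    subst h h'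
    show D (w 0) (w (2 * s + 1))
    have h1 := hw2 0 (by omega)
    rw [Nat.sub_zero] at h1
    rw [h1, hw0, heq]
    exact hfirst₂

/-- Graphs whose exact `s`-subdivisions are induced subgraphs of graphs of the class are sparse. -/
theorem HasDuals.exists_card_edges_le {C : GraphClass} (hC : Hereditary C) (h : HasDuals C) {s : ℕ}
    (hs : 1 ≤ s) : ∃ N, ∀ ⦃n : ℕ⦄ (H : SimpleGraph (Fin n)), MemITMClass s C H →
      Fintype.card (Edges H) ≤ N * n := by
  obtain ⟨m, D, hD⟩ := h.exists_dual (shortcutPath s)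
    (fun i j h => Fin.lt_def.2 (by rcases h with h | h <;> omega)) (fun i j h => Or.inl h)
  refine ⟨m, fun n H hH => ?_⟩
  obtain ⟨n', G, hG, ⟨ε⟩⟩ := hH
  have hhom : ∀ T : Edges H → Bool, ∃ φ : (Fin n ⊕ Σ _ : Edges H, Fin s) → Fin m,
      ∀ x y, subdivArc T x y → D (φ x) (φ y) := by
    intro T
    refine hD.exists_hom hC hG ε (subdivArc T)
      (fun u v h h' => lt_asymm (subdivRank_lt T h) (subdivRank_lt T h'))
      (subdiv_adj_iff T hs) fun f hf => ?_
    set w : ℕ → Fin n ⊕ Σ _ : Edges H, Fin s := fun i =>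
      if hi : i < 2 * s + 1 + 1 then f ⟨i, hi⟩ else f 0 with hw
    have hwf : ∀ i (hi : i < 2 * s + 1 + 1), w i = f ⟨i, hi⟩ := fun i hi => dif_pos hi
    refine not_subdivArc_of_walk T hs (w := w) (fun i hi => ?_) ?_
    · rw [hwf i (by omega), hwf (i + 1) (by omega)]
      exact hf _ _ (Or.inl rfl)
    · rw [hwf 0 (by omega), hwf (2 * s + 1) (by omega)]
      exact hf _ _ (Or.inr ⟨rfl, rfl⟩)
  choose φ hφ using hhom
  have hinj : Function.Injective fun (T : Edges H → Bool) (v : Fin n) => φ T (Sum.inl v) := by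
    intro T T' heq
    by_contra hne
    obtain ⟨e, he⟩ := Function.ne_iff.1 hne
    have heq' := fun v => congrFun heq v
    cases hT : T e <;> cases hT' : T' e
    · exact he (hT.trans hT'.symm)
    · exact hD.1 (exists_shortcutPath_hom hs (hφ T') (hφ T) (fun v => (heq' v).symm) hT' hT)
    · exact hD.1 (exists_shortcutPath_hom hs (hφ T) (hφ T') heq' hT hT')
    · exact he (hT.trans hT'.symm)
  have hc := Fintype.card_le_of_injective _ hinj
  simp only [Fintype.card_fun, Fintype.card_fin, Fintype.card_bool] at hc
  refine (Nat.pow_le_pow_iff_right (a := 2) (by norm_num)).1 (hc.trans ?_)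
  rw [pow_mul]
  exact Nat.pow_le_pow_left (Nat.lt_two_pow_self).le _

/-! ## From subdivisions to induced exact subdivisions -/

theorem card_le_of_charge {E V : Type} {n d : ℕ} (out : V → Finset V)
    (hout : ∀ v, (out v).card ≤ d) (σ : Fin n → V) (P : E → Fin n → V → Prop) (B : Finset E)
    (hB : ∀ e ∈ B, ∃ i, ∃ x ∈ out (σ i), P e i x)
    (huniq : ∀ e e' i x, P e i x → P e' i x → e = e') : B.card ≤ d * n := by
  have hB' : ∀ e : B, ∃ q : Fin n × V, q.2 ∈ out (σ q.1) ∧ P e q.1 q.2 := fun e => by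
    obtain ⟨i, x, hx, h⟩ := hB e e.2
    exact ⟨(i, x), hx, h⟩
  choose q hq1 hq2 using hB'
  have hcard : B.card ≤ (Finset.univ.sigma fun i => out (σ i)).card := by
    rw [← Fintype.card_coe B, ← Finset.card_univ]
    refine Finset.card_le_card_of_injOn (fun e => ⟨(q e).1, (q e).2⟩)
      (fun e _ => Finset.mem_coe.2 (Finset.mem_sigma.2 ⟨Finset.mem_univ _, hq1 e⟩)) ?_
    intro e _ e' _ h
    simp only [Sigma.mk.injEq, heq_eq_eq] at h
    refine Subtype.ext (huniq _ _ _ _ (hq2 e) ?_)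
    rw [h.1, h.2]
    exact hq2 e'
  rw [Finset.card_sigma] at hcard
  refine hcard.trans ((Finset.sum_le_sum fun i _ => hout (σ i)).trans ?_)
  simp [Nat.mul_comm]

/-- The branch vertices and the replacing paths of a subdivision contained in `G`. -/
theorem exists_paths_of_memTM {V : Type} {r : ℕ} {G : SimpleGraph V} {n : ℕ}
    {H : SimpleGraph (Fin n)} (h : MemTM r G H) :
    ∃ (σ : Fin n → V) (R : Edges H → Finset V), Function.Injective σ ∧ (∀ e, (R e).card ≤ r) ∧
      (∀ e i, σ i ∉ R e) ∧ (∀ e e', e ≠ e' → Disjoint (R e) (R e')) ∧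
      ∀ e, Joined G {v | v = σ e.1.1 ∨ v = σ e.1.2 ∨ v ∈ R e} (σ e.1.1) (σ e.1.2) := by
  obtain ⟨t, ht, f, hf⟩ := h
  refine ⟨fun i => f (Sum.inl i), fun e => Finset.univ.image fun k : Fin (t e) =>
    f (Sum.inr ⟨e, k⟩), fun i j hij => Sum.inl.inj (hf hij), fun e => ?_, fun e i hi => ?_,
    fun e e' hee => ?_, fun e => ?_⟩
  · exact Finset.card_image_le.trans (by simpa using ht e)
  · obtain ⟨k, -, hk⟩ := Finset.mem_image.1 hi
    exact absurd (hf hk) (by simp)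
  · refine Finset.disjoint_left.2 fun x hx hx' => ?_
    obtain ⟨k, -, rfl⟩ := Finset.mem_image.1 hx
    obtain ⟨k', -, hk⟩ := Finset.mem_image.1 hx'
    have := hf hk
    simp only [Sum.inr.injEq, Sigma.mk.injEq] at this
    exact hee this.1.symm
  · set S : Set V := {v | v = f (Sum.inl e.1.1) ∨ v = f (Sum.inl e.1.2) ∨
      v ∈ Finset.univ.image fun k : Fin (t e) => f (Sum.inr ⟨e, k⟩)} with hS
    have hadj : ∀ x y, x ≠ y → subdivRel H t x y → G.Adj (f x) (f y) := fun x y hne h =>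
      f.map_adj ((SimpleGraph.fromRel_adj _ _ _).2 ⟨hne, Or.inl h⟩)
    have hmem : ∀ k, f (Sum.inr ⟨e, k⟩) ∈ S := fun k =>
      Or.inr (Or.inr (Finset.mem_image_of_mem _ (Finset.mem_univ k)))
    have ha : f (Sum.inl e.1.1) ∈ S := Or.inl rfl
    have hb : f (Sum.inl e.1.2) ∈ S := Or.inr (Or.inl rfl)
    rcases Nat.eq_zero_or_pos (t e) with h0 | h0
    · refine Joined.of_adj (hadj _ _ ?_ ⟨e.2, h0⟩) ha hb
      exact fun h => e.2.1.ne (Sum.inl.inj h)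
    · have hwalk : ∀ k (hk : k < t e), Joined G S (f (Sum.inl e.1.1)) (f (Sum.inr ⟨e, k, hk⟩)) := by
        intro k
        induction k with
        | zero =>
          exact fun hk => Joined.of_adj (hadj _ _ (by simp) (Or.inl ⟨rfl, rfl⟩)) ha (hmem _)
        | succ k ih =>
          intro hk
          exact (ih (by omega)).trans (Joined.of_adj (hadj _ _ (by simp) ⟨rfl, rfl⟩) (hmem _)
            (hmem _))
      refine (hwalk (t e - 1) (by omega)).trans (Joined.of_adj (hadj _ _ (by simp) ?_).symm
        (hmem _) hb)
      exact Or.inr ⟨rfl, show t e - 1 + 1 = t e by omega⟩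

theorem card_edges_le_of_induced {V : Type} [Fintype V] {G : SimpleGraph V} {d r : ℕ}
    {out : V → Finset V} (hout : ∀ v, (out v).card ≤ d)
    (hcov : ∀ x y, G.Adj x y → y ∈ out x ∨ x ∈ out y) (N : ℕ → ℕ)
    (hN : ∀ s, 1 ≤ s → ∀ ⦃m : ℕ⦄ (H : SimpleGraph (Fin m)), MemITM s G H →
      Fintype.card (Edges H) ≤ N s * m)
    {n : ℕ} {H : SimpleGraph (Fin n)} (hH : MemTM r G H) :
    Fintype.card (Edges H) ≤ (d + d + (2 * (r * d) + 1) * 2 ^ ((r + 2) * d + 2) *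
      ∑ s ∈ Finset.range (r + 1), N s) * n := by
  obtain ⟨σ, R, hσ, hRr, hRσ, hRR, hJ⟩ := exists_paths_of_memTM hH
  set B₁ : Finset (Edges H) := Finset.univ.filter fun e => G.Adj (σ e.1.1) (σ e.1.2) with hB₁
  set B₂ : Finset (Edges H) := Finset.univ.filter fun e => ∃ i, ∃ x ∈ out (σ i),
    (i ≠ e.1.1 ∧ i ≠ e.1.2) ∧ x ∈ R e with hB₂
  have huniq : ∀ e e' x, x ∈ R e → x ∈ R e' → e = e' := by
    intro e e' x hx hx'
    by_contra hne
    exact Finset.disjoint_left.1 (hRR e e' hne) hx hx'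
  have hB₁c : B₁.card ≤ d * n := by
    refine card_le_of_charge out hout σ (fun e i x => (e.1.1 = i ∧ σ e.1.2 = x) ∨
      (e.1.2 = i ∧ σ e.1.1 = x)) B₁ (fun e he => ?_) ?_
    · rcases hcov _ _ (Finset.mem_filter.1 he).2 with h | h
      · exact ⟨_, _, h, Or.inl ⟨rfl, rfl⟩⟩
      · exact ⟨_, _, h, Or.inr ⟨rfl, rfl⟩⟩
    · rintro e e' i x (⟨h1, h2⟩ | ⟨h1, h2⟩) (⟨h3, h4⟩ | ⟨h3, h4⟩)
      · exact Subtype.ext (Prod.ext (h1.trans h3.symm) (hσ (h2.trans h4.symm)))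
      · have h5 := e.2.1
        rw [h1.trans h3.symm, hσ (h2.trans h4.symm)] at h5
        exact absurd h5 (lt_asymm e'.2.1)
      · have h5 := e.2.1
        rw [h1.trans h3.symm, hσ (h2.trans h4.symm)] at h5
        exact absurd h5 (lt_asymm e'.2.1)
      · exact Subtype.ext (Prod.ext (hσ (h2.trans h4.symm)) (h1.trans h3.symm))
  have hB₂c : B₂.card ≤ d * n :=
    card_le_of_charge out hout σ (fun e i x => (i ≠ e.1.1 ∧ i ≠ e.1.2) ∧ x ∈ R e) B₂
      (fun e he => (Finset.mem_filter.1 he).2) fun e e' i x h h' => huniq e e' x h.2 h'.2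
  obtain ⟨W, T, hTS, hcard, hW, hconf⟩ := exists_selection (Finset.univ \ (B₁ ∪ B₂))
    (fun e : Edges H => σ e.1.1) (fun e => σ e.1.2)
    (fun e => (out (σ e.1.1) ∪ out (σ e.1.2) ∪ (R e).biUnion out) \ {σ e.1.1, σ e.1.2})
    (fun e => Finset.univ.filter fun e' => ∃ x ∈ R e, ∃ y ∈ R e', y ∈ out x)
    ((r + 2) * d) (r * d)
    (fun e => by
      have h1 : ((R e).biUnion out).card ≤ r * d :=
        Finset.card_biUnion_le.trans ((Finset.sum_le_sum fun x _ => hout x).trans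
          (by simpa using Nat.mul_le_mul_right d (hRr e)))
      have h2 := Finset.card_union_le (out (σ e.1.1) ∪ out (σ e.1.2)) ((R e).biUnion out)
      have h3 := Finset.card_union_le (out (σ e.1.1)) (out (σ e.1.2))
      have h4 := hout (σ e.1.1)
      have h5 := hout (σ e.1.2)
      refine (Finset.card_le_card Finset.sdiff_subset).trans ?_
      rw [Nat.add_mul]
      omega) (by simp) (by simp)
    (fun e => by
      calc _ ≤ (((R e).biUnion out).biUnion fun y =>
              Finset.univ.filter fun e' => y ∈ R e').card := by
            refine Finset.card_le_card fun e' he' => ?_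
            obtain ⟨x, hx, y, hy, hyx⟩ := (Finset.mem_filter.1 he').2
            exact Finset.mem_biUnion.2 ⟨y, Finset.mem_biUnion.2 ⟨x, hx, hyx⟩,
              Finset.mem_filter.2 ⟨Finset.mem_univ _, hy⟩⟩
        _ ≤ ((R e).biUnion out).card * 1 := Finset.card_biUnion_le_card_mul _ _ _ fun y _ =>
            Finset.card_le_one.2 fun e₁ h₁ e₂ h₂ =>
              huniq e₁ e₂ y (Finset.mem_filter.1 h₁).2 (Finset.mem_filter.1 h₂).2
        _ ≤ r * d := by
            rw [Nat.mul_one]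
            exact Finset.card_biUnion_le.trans ((Finset.sum_le_sum fun x _ => hout x).trans
              (by simpa using Nat.mul_le_mul_right d (hRr e))))
  have hTB : ∀ e ∈ T, e ∉ B₁ ∧ e ∉ B₂ := by
    intro e he
    have := (Finset.mem_sdiff.1 (hTS he)).2
    exact ⟨fun h => this (Finset.mem_union_left _ h), fun h => this (Finset.mem_union_right _ h)⟩
  have hnadj : ∀ e ∈ T, ¬ G.Adj (σ e.1.1) (σ e.1.2) := fun e he h =>
    (hTB e he).1 (Finset.mem_filter.2 ⟨Finset.mem_univ _, h⟩)
  have hZ : ∀ e ∈ T, ∀ i, σ i ∈ W →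
      σ i ∈ out (σ e.1.1) ∪ out (σ e.1.2) ∪ (R e).biUnion out → i = e.1.1 ∨ i = e.1.2 := by
    intro e he i hi hout
    by_contra! hne
    refine Finset.disjoint_left.1 (hW e he).2.2 (Finset.mem_sdiff.2 ⟨hout, ?_⟩) hi
    simp [hσ.eq_iff, hne.1, hne.2]
  set branch : Fin n → Prop := fun i => ∃ e ∈ T, i = e.1.1 ∨ i = e.1.2 with hbranch
  have hbW : ∀ i, branch i → σ i ∈ W := by
    rintro i ⟨e, he, rfl | rfl⟩
    · exact (hW e he).1
    · exact (hW e he).2.1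
  have hσσ : ∀ i j, branch i → branch j → ¬ G.Adj (σ i) (σ j) := by
    have key : ∀ i j, branch i → branch j → σ j ∈ out (σ i) → ¬ G.Adj (σ i) (σ j) := by
      rintro i j ⟨e, he, hi⟩ hj hout hadj
      have h1 : j = e.1.1 ∨ j = e.1.2 := by
        refine hZ e he j (hbW j hj) (Finset.mem_union_left _ ?_)
        rcases hi with rfl | rfl
        · exact Finset.mem_union_left _ hout
        · exact Finset.mem_union_right _ hout
      rcases hi with rfl | rfl <;> rcases h1 with rfl | rfl
      · exact hadj.ne rfl
      · exact hnadj e he hadj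
      · exact hnadj e he hadj.symm
      · exact hadj.ne rfl
    intro i j hi hj hadj
    rcases hcov _ _ hadj with h | h
    · exact key i j hi hj h hadj
    · exact key j i hj hi h hadj.symm
  have hσR : ∀ i, branch i → ∀ e ∈ T, ∀ x ∈ R e, G.Adj (σ i) x → i = e.1.1 ∨ i = e.1.2 := by
    intro i hi e he x hx hadj
    rcases hcov _ _ hadj with h | h
    · by_contra! hne
      exact (hTB e he).2 (Finset.mem_filter.2 ⟨Finset.mem_univ _, i, x, h, hne, hx⟩)
    · exact hZ e he i (hbW i hi)
        (Finset.mem_union_right _ (Finset.mem_biUnion.2 ⟨x, hx, h⟩))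
  have hRR' : ∀ e ∈ T, ∀ e' ∈ T, e ≠ e' → ∀ x ∈ R e, ∀ y ∈ R e', ¬ G.Adj x y := by
    intro e he e' he' hne x hx y hy hadj
    rcases hcov _ _ hadj with h | h
    · exact hconf e he e' he' hne (Finset.mem_filter.2 ⟨Finset.mem_univ _, x, hx, y, hy, h⟩)
    · exact hconf e' he' e he hne.symm
        (Finset.mem_filter.2 ⟨Finset.mem_univ _, y, hy, x, hx, h⟩)
  choose t g ht h0 h1 hadj hinj hgR hind using fun e : Edges H =>
    exists_induced_path (fun h => e.2.1.ne (hσ h)) (hJ e)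
  have htpos : ∀ e ∈ T, 1 ≤ t e := by
    intro e he
    by_contra! hlt
    have ht0 : t e = 0 := by omega
    have h2 := hadj e 0 (Nat.zero_le _)
    have h3 := h1 e
    rw [ht0] at h3
    rw [h0, h3] at h2
    exact hnadj e he h2
  have hclass : ∀ s, (T.filter fun e => t e = s).card ≤ N s * n := by
    intro s
    rcases Nat.eq_zero_or_pos s with rfl | hs
    · rw [Finset.card_eq_zero.2]
      · exact Nat.zero_le _
      · refine Finset.filter_eq_empty_iff.2 fun e he h => ?_
        have := htpos e he
        omega
    obtain ⟨n', hn', H', ι, τ, hτ, hτe, hcard', hends⟩ :=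
      exists_graph_of_edges H (T.filter fun e => t e = s)
    have hτT : ∀ e, τ e ∈ T := fun e => (Finset.mem_filter.1 (hτe e).2.2).1
    have hτs : ∀ e, t (τ e) = s := fun e => (Finset.mem_filter.1 (hτe e).2.2).2
    have hbr : ∀ i, branch (ι i) := fun i => by
      obtain ⟨e, he, h⟩ := hends i
      exact ⟨e, (Finset.mem_filter.1 he).1, h⟩
    have hmem : MemITM s G H' := by
      refine ⟨⟨⟨subdivMap (fun _ => s) (fun i => σ (ι i)) (fun e => g (τ e)),
        subdivMap_injective (R := fun e => R (τ e)) (hσ.comp ι.injective) ?_ ?_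
          (fun e e' hne => hRR _ _ (hτ.ne hne)) fun e i => hRσ _ _⟩, fun {x y} =>
        subdivMap_adj_iff (R := fun e => R (τ e)) ?_ ?_ ?_ ?_
          (fun i j => hσσ _ _ (hbr i) (hbr j)) ?_
          (fun e e' hne => hRR' _ (hτT e) _ (hτT e') (hτ.ne hne)) ?_ x y⟩⟩
      · intro e
        have := hinj (τ e)
        rwa [hτs] at this
      · intro e
        have := hgR (τ e)
        rwa [hτs] at this
      · intro e
        have := hgR (τ e)
        rwa [hτs] at this
      · intro e
        rw [h0, (hτe e).1]
      · intro e
        rw [← (hτe e).2.1, ← h1, hτs]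
      · intro e
        have := hadj (τ e)
        rwa [hτs] at this
      · intro i e x hx hix
        have := hσR _ (hbr i) _ (hτT e) x hx hix
        rw [(hτe e).1, (hτe e).2.1] at this
        exact this.imp (fun h => ι.injective h) fun h => ι.injective h
      · intro e
        have := hind (τ e)
        rwa [hτs] at this
    rw [← hcard']
    exact (hN s hs H' hmem).trans (Nat.mul_le_mul_left _ hn')
  have hTc : T.card ≤ (∑ s ∈ Finset.range (r + 1), N s) * n := by
    rw [Finset.card_eq_sum_card_fiberwise (f := t) (t := Finset.range (r + 1))
      (fun e _ => by simpa using Nat.lt_succ_of_le ((ht e).trans (hRr e))), Finset.sum_mul]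
    exact Finset.sum_le_sum fun s _ => hclass s
  have hsplit : Fintype.card (Edges H) ≤ (B₁ ∪ B₂).card + (Finset.univ \ (B₁ ∪ B₂)).card := by
    rw [← Finset.card_univ]
    refine (Finset.card_le_card fun e _ => ?_).trans (Finset.card_union_le _ _)
    by_cases he : e ∈ B₁ ∪ B₂
    · exact Finset.mem_union_left _ he
    · exact Finset.mem_union_right _ (Finset.mem_sdiff.2 ⟨Finset.mem_univ _, he⟩)
  have hunion := Finset.card_union_le B₁ B₂
  calc Fintype.card (Edges H) ≤ d * n + d * n + (2 * (r * d) + 1) * 2 ^ ((r + 2) * d + 2) *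
        ((∑ s ∈ Finset.range (r + 1), N s) * n) := by
        have := hcard.trans (Nat.mul_le_mul_left _ hTc)
        omega
    _ = _ := by ring

theorem HasDuals.omegaBoundedExpansion {C : GraphClass} (hC : Hereditary C) (h : HasDuals C) :
    OmegaBoundedExpansion C := by
  choose d hd using h.exists_out hC
  have hN : ∀ s, ∃ N, 1 ≤ s → ∀ ⦃n : ℕ⦄ (H : SimpleGraph (Fin n)), MemITMClass s C H →
      Fintype.card (Edges H) ≤ N * n := by
    intro s
    by_cases hs : 1 ≤ s
    · obtain ⟨N, hN⟩ := h.exists_card_edges_le hC hs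
      exact ⟨N, fun _ => hN⟩
    · exact ⟨0, fun h => absurd h hs⟩
  choose N hN using hN
  refine ⟨fun k r => 2 * ((d k + d k + (2 * (r * d k) + 1) * 2 ^ ((r + 2) * d k + 2) *
    ∑ s ∈ Finset.range (r + 1), N s : ℕ) : ℝ), fun n G hG r m H hH => ?_⟩
  obtain ⟨out, hout, hcov⟩ := hd _ G hG le_rfl
  exact avgDeg_le_of_card_edges_le (card_edges_le_of_induced hout hcov N
    (fun s hs m H hH => hN s hs H ⟨n, G, hG, hH⟩) hH)

end RestrictedDuals

/-- For a hereditary class `𝒞`, every connected acyclically oriented graph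
has a restricted dual for the class of all orientations of graphs of `𝒞` iff `𝒞` has
`ω`-bounded expansion. -/
theorem restricted_duals_iff_omegaBE (C : GraphClass) (hC : Hereditary C) :
    (∀ (nF : ℕ) (F : Fin nF → Fin nF → Prop),
        IsAcyclicDigraph F → (SimpleGraph.fromRel F).Connected →
        HasRestrictedDualForOrientations C F) ↔
      OmegaBoundedExpansion C := by
  exact ⟨RestrictedDuals.HasDuals.omegaBoundedExpansion hC, fun h _ F hF hFc =>
    RestrictedDuals.hasRestrictedDual_of_omegaBoundedExpansion h F hF hFc⟩
end

section
/- The class ℬ of all complete bipartite graphs K_{s,t} (s, t ≥ 1) is weakly χ_p-bounded for every positive integer p, but is not strongly χ_2-bounded. Explicitly: (a) for every integer p ≥ 2 and all integers 1 ≤ s ≤ t, one has χ_p(K_{s,t}) ≤ s + 1 and χ_p(K_{s,t}) ≤ ω(TM_{p-1}(K_{s,t}))^2; (b) ω(K_{n,n}) = 2 for every n ≥ 1 while sup_n χ_2(K_{n,n}) = ∞. -/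
open SimpleGraph

/-- The class of all complete bipartite graphs `K_{s,t}` with `s, t ≥ 1`. -/
def CompleteBipartiteClass : GraphClass := fun n =>
  {G : SimpleGraph (Fin n) | ∃ s t : ℕ, 1 ≤ s ∧ 1 ≤ t ∧
    Nonempty (G ≃g completeBipartiteGraph (Fin s) (Fin t))}

/-! ## Invariance under isomorphism -/

theorem IsSubgraphOf.trans {U V W : Type*} {F : SimpleGraph U} {G : SimpleGraph V}
    {H : SimpleGraph W} (h₁ : IsSubgraphOf F G) (h₂ : IsSubgraphOf G H) : IsSubgraphOf F H := by
  obtain ⟨f, hf⟩ := h₁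
  obtain ⟨g, hg⟩ := h₂
  exact ⟨g.comp f, hg.comp hf⟩

theorem SimpleGraph.Iso.isSubgraphOf {V W : Type*} {G : SimpleGraph V} {H : SimpleGraph W}
    (e : G ≃g H) : IsSubgraphOf G H :=
  ⟨e.toHom, e.injective⟩

theorem isSubgraphOf_congr {U V W : Type*} (F : SimpleGraph U) {G : SimpleGraph V}
    {H : SimpleGraph W} (e : G ≃g H) : IsSubgraphOf F G ↔ IsSubgraphOf F H :=
  ⟨fun h => h.trans e.isSubgraphOf, fun h => h.trans e.symm.isSubgraphOf⟩

theorem omegaNum_congr {V W : Type*} {G : SimpleGraph V} {H : SimpleGraph W} (e : G ≃g H) :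
    omegaNum G = omegaNum H := by
  simp only [omegaNum, isSubgraphOf_congr _ e]

theorem omegaTM_congr {V W : Type*} {G : SimpleGraph V} {H : SimpleGraph W} (e : G ≃g H) (r : ℕ) :
    omegaTM r G = omegaTM r H := by
  simp only [omegaTM, MemTM, isSubgraphOf_congr _ e]

theorem TreeDepthLE.of_isSubgraphOf {V W : Type*} [Finite W] {G : SimpleGraph V}
    {H : SimpleGraph W} {h : ℕ} (hH : TreeDepthLE H h) (hG : IsSubgraphOf G H) :
    TreeDepthLE G h := by
  obtain ⟨r, ⟨hrefl, hanti, htrans, hchain⟩, hadj, hcard⟩ := hH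
  obtain ⟨f, hf⟩ := hG
  refine ⟨fun u v => r (f u) (f v), ⟨fun v => hrefl _, fun u v h₁ h₂ => hf (hanti _ _ h₁ h₂),
    fun u v w => htrans _ _ _, fun u v w => hchain _ _ _⟩, fun u v h => hadj _ _ (f.map_adj h),
    fun v => le_trans ?_ (hcard (f v))⟩
  exact Set.ncard_le_ncard_of_injOn f (fun u hu => hu) hf.injOn (Set.toFinite _)

theorem treeDepthLE_induce_comp_iso {V W : Type*} [Finite W] {G : SimpleGraph V} {H : SimpleGraph W}
    (e : G ≃g H) (p : ℕ) {N : ℕ} (c : W → Fin N)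
    (hc : ∀ I : Finset (Fin N), I.card ≤ p → TreeDepthLE (H.induce {v | c v ∈ I}) I.card) :
    ∀ I : Finset (Fin N), I.card ≤ p →
      TreeDepthLE (G.induce {v | (c ∘ e) v ∈ I}) I.card := fun I hI =>
  (hc I hI).of_isSubgraphOf
    ⟨⟨fun v => ⟨e v.1, v.2⟩, fun h => e.map_adj_iff.2 h⟩,
      fun _ _ h => Subtype.ext (e.injective (congrArg Subtype.val h))⟩

theorem chiP_congr {V W : Type*} [Finite V] [Finite W] {G : SimpleGraph V} {H : SimpleGraph W}
    (e : G ≃g H) (p : ℕ) : chiP G p = chiP H p := by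
  unfold chiP
  congr 1
  ext N
  exact ⟨fun ⟨c, hc⟩ => ⟨_, treeDepthLE_induce_comp_iso e.symm p c hc⟩,
    fun ⟨c, hc⟩ => ⟨_, treeDepthLE_induce_comp_iso e p c hc⟩⟩

/-! ## Upper bounds on `χ_p` -/

/-- A colouring that is injective on every root-to-vertex path of a forest whose closure
contains `G` certifies the tree-depth bounds defining `χ_p`. -/
theorem treeDepthLE_induce_of_injOn {V α : Type*} {G : SimpleGraph V} {r : V → V → Prop}
    (hr : IsForestOrder r) (hadj : ∀ u v, G.Adj u v → r u v ∨ r v u) {c : V → α}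
    (hc : ∀ v, Set.InjOn c {u | r u v}) (I : Finset α) :
    TreeDepthLE (G.induce {v | c v ∈ I}) I.card := by
  obtain ⟨hrefl, hanti, htrans, hchain⟩ := hr
  refine ⟨fun u v => r u v, ⟨fun v => hrefl _, fun u v h₁ h₂ => Subtype.ext (hanti _ _ h₁ h₂),
    fun u v w => htrans _ _ _, fun u v w => hchain _ _ _⟩, fun u v h => hadj _ _ h, fun v => ?_⟩
  rw [← Set.ncard_coe_finset]
  exact Set.ncard_le_ncard_of_injOn (fun u => c u.1) (fun u _ => u.2)
    (fun u hu w hw h => Subtype.ext (hc v hu hw h)) I.finite_toSet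

/-- The ancestor order of the tree in which `Fin s` is a path from the root and every element
of `Fin t` is a leaf attached to the end of this path. -/
def broomOrder {s t : ℕ} : Fin s ⊕ Fin t → Fin s ⊕ Fin t → Prop
  | Sum.inl i, Sum.inl j => i ≤ j
  | Sum.inl _, Sum.inr _ => True
  | Sum.inr _, Sum.inl _ => False
  | Sum.inr i, Sum.inr j => i = j

theorem isForestOrder_broomOrder (s t : ℕ) : IsForestOrder (broomOrder (s := s) (t := t)) := by
  refine ⟨?_, ?_, ?_, ?_⟩
  · rintro (i | i) <;> simp [broomOrder]
  · rintro (i | i) (j | j) <;> simp [broomOrder]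
    · exact fun h₁ h₂ => le_antisymm h₁ h₂
    · exact fun h _ => h
  · rintro (i | i) (j | j) (k | k) <;> simp [broomOrder]
    · exact fun h₁ h₂ => le_trans h₁ h₂
    · exact fun h₁ h₂ => h₁.trans h₂
  · rintro (i | i) (j | j) (k | k) <;> simp [broomOrder]
    · exact fun _ _ => le_total i j
    · exact le_total i j
    · exact fun h₁ h₂ => Or.inl (h₁.trans h₂.symm)

theorem exists_coloring_completeBipartite (p s t : ℕ) :
    ∃ c : Fin s ⊕ Fin t → Fin (s + 1), ∀ I : Finset (Fin (s + 1)), I.card ≤ p →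
      TreeDepthLE ((completeBipartiteGraph (Fin s) (Fin t)).induce {v | c v ∈ I}) I.card := by
  refine ⟨Sum.elim Fin.castSucc (fun _ => Fin.last s), fun I _ =>
    treeDepthLE_induce_of_injOn (isForestOrder_broomOrder s t) ?_ ?_ I⟩
  · rintro (i | i) (j | j) <;> simp [broomOrder]
  · rintro (k | k) (i | i) hi (j | j) hj <;> simp [broomOrder] at hi hj ⊢
    · exact (Fin.castSucc_lt_last j).ne'
    · exact hi.trans hj.symm

theorem chiP_completeBipartite_le (p s t : ℕ) :
    chiP (completeBipartiteGraph (Fin s) (Fin t)) p ≤ s + 1 :=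
  Nat.sInf_le (exists_coloring_completeBipartite p s t)

theorem chiP_one_le_of_colorable {V : Type*} {G : SimpleGraph V} {N : ℕ} (h : G.Colorable N) :
    chiP G 1 ≤ N := by
  obtain ⟨c⟩ := h
  refine Nat.sInf_le ⟨c, fun I hI => ⟨Eq, ⟨fun _ => rfl, fun _ _ h _ => h,
    fun _ _ _ => Eq.trans, fun _ _ _ h₁ h₂ => Or.inl (h₁.trans h₂.symm)⟩, fun u v huv => ?_,
    fun v => ?_⟩⟩
  · exact absurd (Finset.card_le_one.1 hI _ u.2 _ v.2) (c.valid huv)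
  · simpa using Finset.card_pos.2 ⟨_, v.2⟩

/-! ## Lower bound on `χ_2` -/

theorem not_treeDepthLE_two_of_fourCycle {V : Type*} [Finite V] {G : SimpleGraph V}
    {x y x' y' : V} (hx : x ≠ x') (hy : y ≠ y') (h₁ : G.Adj x y) (h₂ : G.Adj y x')
    (h₃ : G.Adj y' x) : ¬ TreeDepthLE G 2 := by
  rintro ⟨r, ⟨hrefl, -, htrans, -⟩, hadj, hcard⟩
  have key : ∀ a b d v : V, a ≠ b → a ≠ d → b ≠ d → r a v → r b v → r d v → False := by
    intro a b d v hab had hbd ha hb hd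
    have hsub : ({a, b, d} : Set V) ⊆ {u | r u v} := by
      rintro u (rfl | rfl | rfl) <;> assumption
    have h3 : ({a, b, d} : Set V).ncard = 3 := Set.ncard_eq_three.2 ⟨a, b, d, hab, had, hbd, rfl⟩
    have := Set.ncard_le_ncard hsub (Set.toFinite _)
    have := hcard v
    omega
  rcases hadj _ _ h₁ with h | h
  · rcases hadj _ _ h₂ with h' | h'
    · exact key x y x' x' h₁.ne hx h₂.ne (htrans _ _ _ h h') h' (hrefl _)
    · exact key x y x' y h₁.ne hx h₂.ne h (hrefl _) h'
  · rcases hadj _ _ h₃ with h' | h'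
    · exact key y x y' x h₁.ne' hy h₃.ne' h (hrefl _) h'
    · exact key y x y' y' h₁.ne' hy h₃.ne' (htrans _ _ _ h h') h' (hrefl _)

theorem TreeDepthLE.mono {V : Type*} {G : SimpleGraph V} {h k : ℕ} (hG : TreeDepthLE G h)
    (hk : h ≤ k) : TreeDepthLE G k := by
  obtain ⟨r, hr, hadj, hcard⟩ := hG
  exact ⟨r, hr, hadj, fun v => (hcard v).trans hk⟩

theorem le_chiP_two_completeBipartite (n : ℕ) :
    n ≤ chiP (completeBipartiteGraph (Fin n) (Fin n)) 2 := by
  obtain ⟨c, hc⟩ := Nat.sInf_mem (s := {N | ∃ c : Fin n ⊕ Fin n → Fin N,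
    ∀ I : Finset (Fin N), I.card ≤ 2 →
    TreeDepthLE ((completeBipartiteGraph (Fin n) (Fin n)).induce {v | c v ∈ I}) I.card})
    ⟨_, exists_coloring_completeBipartite 2 n n⟩
  change n ≤ sInf {N | ∃ c : Fin n ⊕ Fin n → Fin N, _}
  by_contra! hlt
  obtain ⟨x, x', hx, hxc⟩ := Fintype.exists_ne_map_eq_of_card_lt (fun i => c (Sum.inl i))
    (by simpa using hlt)
  obtain ⟨y, y', hy, hyc⟩ := Fintype.exists_ne_map_eq_of_card_lt (fun i => c (Sum.inr i))
    (by simpa using hlt)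
  have hI := Finset.card_le_two (a := c (Sum.inl x)) (b := c (Sum.inr y))
  refine not_treeDepthLE_two_of_fourCycle
    (x := ⟨Sum.inl x, by simp⟩) (x' := ⟨Sum.inl x', by simp [← hxc]⟩)
    (y := ⟨Sum.inr y, by simp⟩) (y' := ⟨Sum.inr y', by simp [← hyc]⟩)
    ?_ ?_ ?_ ?_ ?_ ((hc _ hI).mono hI)
  all_goals simp [hx, hy]

/-! ## Clique numbers -/

theorem IsSubgraphOf.card_le {V W : Type*} [Fintype V] [Fintype W] {G : SimpleGraph V}
    {H : SimpleGraph W} (h : IsSubgraphOf G H) : Fintype.card V ≤ Fintype.card W := by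
  obtain ⟨f, hf⟩ := h
  exact Fintype.card_le_of_injective f hf

theorem omegaNum_le_card {V : Type*} [Fintype V] (G : SimpleGraph V) :
    omegaNum G ≤ Fintype.card V :=
  csSup_le' fun m hm => by simpa using IsSubgraphOf.card_le hm

theorem omegaNum_top (n : ℕ) : omegaNum (⊤ : SimpleGraph (Fin n)) = n := by
  refine le_antisymm (by simpa using omegaNum_le_card (⊤ : SimpleGraph (Fin n))) ?_
  exact le_csSup ⟨n, fun m hm => by simpa using IsSubgraphOf.card_le hm⟩ (Iso.refl.isSubgraphOf)

theorem omegaNum_completeBipartite {s t : ℕ} (hs : 1 ≤ s) (ht : 1 ≤ t) :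
    omegaNum (completeBipartiteGraph (Fin s) (Fin t)) = 2 := by
  have hub : ∀ m, IsSubgraphOf (⊤ : SimpleGraph (Fin m))
      (completeBipartiteGraph (Fin s) (Fin t)) → m ≤ 2 := by
    rintro m ⟨f, -⟩
    have hinj : Function.Injective fun i => (f i).isLeft := by
      intro i j (hij : (f i).isLeft = (f j).isLeft)
      by_contra hne
      have := f.map_adj ((top_adj i j).2 hne)
      revert this
      generalize f i = x at hij ⊢
      generalize f j = y at hij ⊢
      revert hij
      cases x <;> cases y <;> simp
    simpa using Fintype.card_le_of_injective _ hinj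
  refine le_antisymm (csSup_le' hub) (le_csSup ⟨2, hub⟩ ?_)
  let f : Fin 2 → Fin s ⊕ Fin t := ![Sum.inl ⟨0, hs⟩, Sum.inr ⟨0, ht⟩]
  have hf : ∀ i j, i ≠ j → (completeBipartiteGraph (Fin s) (Fin t)).Adj (f i) (f j) := by
    intro i j
    fin_cases i <;> fin_cases j <;> simp [f]
  exact ⟨⟨f, fun {i j} h => hf i j h⟩, fun i j h => by
    by_contra hne
    exact (hf i j hne).ne h⟩

theorem le_omegaTM {W : Type*} [Fintype W] {G : SimpleGraph W} {r m : ℕ}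
    (h : MemTM r G (⊤ : SimpleGraph (Fin m))) : m ≤ omegaTM r G := by
  refine le_csSup ⟨Fintype.card W, ?_⟩ ⟨m, ⊤, h, omegaNum_top m⟩
  rintro _ ⟨k, H, ⟨t, -, f, hf⟩, rfl⟩
  refine (omegaNum_le_card H).trans ?_
  exact Fintype.card_le_of_injective (fun i => f (Sum.inl i)) (hf.comp Sum.inl_injective)

/-! ## Subdivided cliques in complete bipartite graphs -/

theorem memTM_top_completeBipartite {a s t r : ℕ} (hr : 1 ≤ r) (hs : (a + 1).choose 2 ≤ s)
    (ht : (a + 1).choose 2 ≤ t) :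
    MemTM r (completeBipartiteGraph (Fin s) (Fin t)) (⊤ : SimpleGraph (Fin (a + a))) := by
  obtain ⟨φ⟩ := Function.Embedding.nonempty_of_card_le (α := Sym2 (Fin a)) (β := Fin s)
    (by simpa [Sym2.card] using hs)
  obtain ⟨ψ⟩ := Function.Embedding.nonempty_of_card_le (α := Sym2 (Fin a)) (β := Fin t)
    (by simpa [Sym2.card] using ht)
  let side : Fin (a + a) → Bool := fun x => (finSumFinEquiv.symm x).isLeft
  let idx : Fin (a + a) → Fin a := fun x => (finSumFinEquiv.symm x).elim id id
  have hinj : ∀ x y, side x = side y → idx x = idx y → x = y := by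
    intro x y h₁ h₂
    apply finSumFinEquiv.symm.injective
    revert h₁ h₂
    simp only [side, idx]
    rcases finSumFinEquiv.symm x <;> rcases finSumFinEquiv.symm y <;> simp
  let place : Bool → Sym2 (Fin a) → Fin s ⊕ Fin t :=
    fun b q => if b then Sum.inl (φ q) else Sum.inr (ψ q)
  have hplace : ∀ b b' q q', place b q = place b' q' → b = b' ∧ q = q' := by
    intro b b' q q'
    cases b <;> cases b' <;> simp [place]
  have hplace_adj : ∀ b b' q q', b ≠ b' →
      (completeBipartiteGraph (Fin s) (Fin t)).Adj (place b q) (place b' q') := by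
    intro b b' q q'
    cases b <;> cases b' <;> simp [place]
  let len : Edges (⊤ : SimpleGraph (Fin (a + a))) → ℕ :=
    fun e => if side e.1.1 = side e.1.2 then 1 else 0
  have hlen : ∀ e, len e ≤ 1 := fun e => by
    simp only [len]
    split <;> omega
  have hside : ∀ e, Fin (len e) → side e.1.1 = side e.1.2 := by
    intro e i
    by_contra h
    have := i.2
    simp [len, h] at this
  let F : (Fin (a + a) ⊕ Σ e, Fin (len e)) → Fin s ⊕ Fin t :=
    Sum.elim (fun x => place (side x) s(idx x, idx x))
      (fun q => place (!side q.1.1.1) s(idx q.1.1.1, idx q.1.1.2))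
  have hrel : ∀ u v, subdivRel ⊤ len u v →
      (completeBipartiteGraph (Fin s) (Fin t)).Adj (F u) (F v) := by
    rintro (x | ⟨e, i⟩) (y | ⟨e', j⟩) h
    · obtain ⟨hxy, h0⟩ := h
      refine hplace_adj _ _ _ _ fun h => ?_
      simp [len, h] at h0
    · have := hside e' j
      refine hplace_adj _ _ _ _ ?_
      rcases h with ⟨rfl, -⟩ | ⟨rfl, -⟩ <;> simp [this]
    · exact h.elim
    · obtain ⟨rfl, h⟩ := h
      have := hlen e
      omega
  have hne : ∀ e (_ : Fin (len e)), idx e.1.1 ≠ idx e.1.2 := fun e i h =>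
    e.2.1.ne (hinj _ _ (hside e i) h)
  refine ⟨len, fun e => (hlen e).trans hr, ⟨F, ?_⟩, ?_⟩
  · rintro u v ⟨-, h | h⟩
    · exact hrel u v h
    · exact (hrel v u h).symm
  · rintro (x | ⟨e, i⟩) (y | ⟨e', j⟩) h <;> obtain ⟨h₁, h₂⟩ := hplace _ _ _ _ h
    · rw [hinj x y h₁ (by simpa using h₂)]
    · refine absurd ?_ (hne e' j)
      rcases Sym2.eq_iff.1 h₂ with ⟨h, h'⟩ | ⟨h, h'⟩
      · exact h.symm.trans h'
      · exact h'.symm.trans h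
    · refine absurd ?_ (hne e i)
      rcases Sym2.eq_iff.1 h₂ with ⟨h, h'⟩ | ⟨h, h'⟩ <;> exact h.trans h'.symm
    · have hs₁ : side e.1.1 = side e'.1.1 := by simpa using h₁
      have hs := hside e i
      have hs' := hside e' j
      have he : e = e' := by
        rcases Sym2.eq_iff.1 h₂ with ⟨h, h'⟩ | ⟨h, h'⟩
        · exact Subtype.ext (Prod.ext (hinj _ _ hs₁ h)
            (hinj _ _ (hs.symm.trans (hs₁.trans hs')) h'))
        · have h3 := hinj _ _ (hs₁.trans hs') h
          have h4 := hinj _ _ (hs.symm.trans hs₁) h'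
          have h5 := e.2.1
          rw [h3, h4] at h5
          exact absurd e'.2.1 h5.asymm
      subst he
      have : i = j := Fin.ext (by have := hlen e; omega)
      rw [this]

theorem succ_le_omegaTM_sq {r s t : ℕ} (hr : 1 ≤ r) (hs : 1 ≤ s) (hst : s ≤ t) :
    s + 1 ≤ omegaTM r (completeBipartiteGraph (Fin s) (Fin t)) ^ 2 := by
  have hP : (1 + 1).choose 2 ≤ s := by simpa using hs
  let a := Nat.findGreatest (fun a => (a + 1).choose 2 ≤ s) s
  have ha : (a + 1).choose 2 ≤ s := Nat.findGreatest_spec (P := fun a => (a + 1).choose 2 ≤ s) hs hP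
  have ha1 : 1 ≤ a := Nat.le_findGreatest hs hP
  have ha2 : s < (a + 1 + 1).choose 2 := by
    by_contra! h
    have hle : a + 1 ≤ (a + 1 + 1).choose 2 := by
      rw [Nat.choose_succ_succ' (a + 1) 1, Nat.choose_one_right]
      omega
    have : a + 1 ≤ a := Nat.le_findGreatest (hle.trans h) h
    omega
  have hm := le_omegaTM (memTM_top_completeBipartite hr ha (ha.trans hst))
  calc s + 1 ≤ (a + 1 + 1).choose 2 := ha2
    _ ≤ (a + a) ^ 2 := by
      have h2 : (a + 1 + 1).choose 2 ≤ (a + 2) * (a + 1) / 2 := by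
        rw [Nat.choose_two_right]
        simp
      have h3 : (a + 2) * (a + 1) ≤ 2 * (a + a) ^ 2 := by nlinarith
      omega
    _ ≤ _ := Nat.pow_le_pow_left hm 2

theorem chiP_le_omegaTM_sq {p s t : ℕ} (hp : 2 ≤ p) (hs : 1 ≤ s) (hst : s ≤ t) :
    chiP (completeBipartiteGraph (Fin s) (Fin t)) p ≤
      omegaTM (p - 1) (completeBipartiteGraph (Fin s) (Fin t)) ^ 2 :=
  (chiP_completeBipartite_le p s t).trans (succ_le_omegaTM_sq (by omega) hs hst)

/-! ## The class of complete bipartite graphs -/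

/-- Exchanging the two sides of a complete bipartite graph. -/
def completeBipartiteSwap (α β : Type*) :
    completeBipartiteGraph α β ≃g completeBipartiteGraph β α :=
  ⟨Equiv.sumComm α β, by rintro (_ | _) (_ | _) <;> simp⟩

theorem weaklyChiPBounded_completeBipartiteClass {p : ℕ} (hp : 1 ≤ p) :
    WeaklyChiPBounded CompleteBipartiteClass p := by
  rcases hp.eq_or_lt with rfl | hp
  · refine ⟨fun _ => 2, ?_⟩
    rintro n G ⟨s, t, -, -, ⟨e⟩⟩
    rw [chiP_congr e]
    exact chiP_one_le_of_colorable
      (by simpa using (CompleteBipartiteGraph.bicoloring (Fin s) (Fin t)).colorable)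
  · refine ⟨fun m => m ^ 2, ?_⟩
    rintro n G ⟨s, t, hs, ht, ⟨e⟩⟩
    rcases le_total s t with h | h
    · rw [chiP_congr e, omegaTM_congr e]
      exact chiP_le_omegaTM_sq hp hs h
    · have e' := e.trans (completeBipartiteSwap _ _)
      rw [chiP_congr e', omegaTM_congr e']
      exact chiP_le_omegaTM_sq hp ht h

theorem not_stronglyChiPBounded_completeBipartiteClass :
    ¬ StronglyChiPBounded CompleteBipartiteClass 2 := by
  rintro ⟨f, hf⟩
  let n := f 2 + 1
  let e := Iso.map (finSumFinEquiv (m := n) (n := n)) (completeBipartiteGraph (Fin n) (Fin n))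
  have hn : 1 ≤ n := Nat.le_add_left _ _
  have h := hf _ ⟨n, n, hn, hn, ⟨e.symm⟩⟩
  rw [chiP_congr e.symm, omegaNum_congr e.symm, omegaNum_completeBipartite hn hn] at h
  have := le_chiP_two_completeBipartite n
  omega

/-- The class of complete bipartite graphs is weakly `χ_p`-bounded for every
positive `p` but not strongly `χ_2`-bounded; explicitly, (a) for `p ≥ 2` and `1 ≤ s ≤ t`,
`χ_p(K_{s,t}) ≤ s+1` and `χ_p(K_{s,t}) ≤ ω(TM_{p-1}(K_{s,t}))²`; (b) `ω(K_{n,n}) = 2` for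
`n ≥ 1` while `sup_n χ_2(K_{n,n}) = ∞`. -/
theorem complete_bipartite_weakly_not_strongly :
    (∀ p : ℕ, 1 ≤ p → WeaklyChiPBounded CompleteBipartiteClass p) ∧
    ¬ StronglyChiPBounded CompleteBipartiteClass 2 ∧
    (∀ p s t : ℕ, 2 ≤ p → 1 ≤ s → s ≤ t →
      chiP (completeBipartiteGraph (Fin s) (Fin t)) p ≤ s + 1 ∧
      chiP (completeBipartiteGraph (Fin s) (Fin t)) p ≤
        omegaTM (p - 1) (completeBipartiteGraph (Fin s) (Fin t)) ^ 2) ∧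
    (∀ n : ℕ, 1 ≤ n → omegaNum (completeBipartiteGraph (Fin n) (Fin n)) = 2) ∧
    (∀ M : ℕ, ∃ n : ℕ, M ≤ chiP (completeBipartiteGraph (Fin n) (Fin n)) 2) := by
  refine ⟨fun p => weaklyChiPBounded_completeBipartiteClass,
    not_stronglyChiPBounded_completeBipartiteClass,
    fun p s t hp hs hst => ⟨chiP_completeBipartite_le p s t, chiP_le_omegaTM_sq hp hs hst⟩,
    fun n hn => omegaNum_completeBipartite hn hn,
    fun M => ⟨M, le_chiP_two_completeBipartite M⟩⟩
end
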